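/- arXiv:2001.00905 — 5 statements merged into one kernel-verified Lean document; each statement's English description precedes it below -/
import Mathlib

section
/- Let (T,d,μ) be a semi-measured real tree with associated long dendron D = (Core(T), d, ν) and associated projection α. Then the feathers of T are exactly the p-branches of μ-measure zero over points p ∈ Core(T). Moreover, for all x,y ∈ T that do not lie in the same feather of T, one has d(x,y) = d_D(α(x),α(y)). -/
open scoped NNReal ENNReal

noncomputable section

/-- `(T,d)` is a real tree: a nonempty complete metric space in which any two distinct
points are joined by an isometric arc all of whose intermediate points separate them. -/
def IsRealTree (T : Type*) [MetricSpace T] : Prop :=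
  Nonempty T ∧ CompleteSpace T ∧
    ∀ p q : T, p ≠ q → ∃ a b : ℝ, a < b ∧ ∃ α : ℝ → T,
      (∀ s ∈ Set.Icc a b, ∀ t ∈ Set.Icc a b, dist (α s) (α t) = |s - t|) ∧
      α a = p ∧ α b = q ∧
      ∀ c : ℝ, a < c → c < b →
        connectedComponentIn ({α c}ᶜ) p ≠ connectedComponentIn ({α c}ᶜ) q

/-- `S` is the segment `[x,y]`. -/
def IsSegment {T : Type*} [MetricSpace T] (x y : T) (S : Set T) : Prop :=
  ∃ a b : ℝ, a ≤ b ∧ ∃ α : ℝ → T,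
    (∀ s ∈ Set.Icc a b, ∀ t ∈ Set.Icc a b, dist (α s) (α t) = |s - t|) ∧
    α a = x ∧ α b = y ∧ S = α '' Set.Icc a b ∧
    ∀ c : ℝ, a < c → c < b →
      connectedComponentIn ({α c}ᶜ) x ≠ connectedComponentIn ({α c}ᶜ) y

/-- `B` is a `p`-branch: a connected component of `T \ {p}`. -/
def IsBranchAt {T : Type*} [MetricSpace T] (p : T) (B : Set T) : Prop :=
  ∃ x : T, x ≠ p ∧ B = connectedComponentIn ({p}ᶜ) x

/-- `B` is a branch of `T`. -/
def IsBranch {T : Type*} [MetricSpace T] (B : Set T) : Prop :=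
  ∃ p : T, IsBranchAt p B

/-- A subtree: a nonempty, closed, connected subset. -/
def IsSubtree {T : Type*} [MetricSpace T] (Y : Set T) : Prop :=
  Y.Nonempty ∧ IsClosed Y ∧ IsPreconnected Y

/-- The sampling map `ρ_r`. -/
def rho {X : Type*} (d : X → X → ℝ) (r : ℕ) (x : Fin r → X) : Fin r → Fin r → ℝ :=
  fun i j => if i = j then 0 else d (x i) (x j)

/-- The sampling measure `τ_r(X,d,μ)`: push-forward of `μ^r` along `ρ_r`. -/
def samplingMeasure {X : Type*} [MeasurableSpace X] (d : X → X → ℝ) (r : ℕ)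
    (μ : MeasureTheory.Measure X) : MeasureTheory.Measure (Fin r → Fin r → ℝ) :=
  MeasureTheory.Measure.map (rho d r) (MeasureTheory.Measure.pi fun _ => μ)

/-- Weak convergence of a sequence of measures. -/
def WeakTendsto {Ω : Type*} [MeasurableSpace Ω] [TopologicalSpace Ω]
    (μ : ℕ → MeasureTheory.Measure Ω) (ν : MeasureTheory.Measure Ω) : Prop :=
  ∀ g : BoundedContinuousFunction Ω ℝ,
    Filter.Tendsto (fun n => ∫ x, g x ∂(μ n)) Filter.atTop (nhds (∫ x, g x ∂ν))

/-- A point `p` is an inner point if no `p`-branch has full measure. -/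
def IsInnerPoint {T : Type*} [MetricSpace T] [MeasurableSpace T]
    (μ : MeasureTheory.Measure T) (p : T) : Prop :=
  ¬ ∃ B : Set T, IsBranchAt p B ∧ μ B = 1

/-- The core: the closure of the set of inner points. -/
def treeCore {T : Type*} [MetricSpace T] [MeasurableSpace T]
    (μ : MeasureTheory.Measure T) : Set T :=
  closure {p : T | IsInnerPoint μ p}

/-- Feathers: the connected components of `T \ Core(T)`. -/
def IsFeather {T : Type*} [MetricSpace T] [MeasurableSpace T]
    (μ : MeasureTheory.Measure T) (F : Set T) : Prop :=
  ∃ x : T, x ∉ treeCore μ ∧ F = connectedComponentIn ((treeCore μ)ᶜ) x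

/-- A long dendron: a real tree together with a Borel probability measure on
`A_D = T × [0,∞)` giving positive mass to `B × [0,∞)` for every branch `B` of `T`. -/
structure LongDendron where
  carrier : Type
  [met : MetricSpace carrier]
  [meas : MeasurableSpace carrier]
  [borelSpace : BorelSpace carrier]
  isRealTree : IsRealTree carrier
  ν : MeasureTheory.Measure (carrier × ℝ≥0)
  isProb : MeasureTheory.IsProbabilityMeasure ν
  branch_pos : ∀ B : Set carrier, IsBranch B → 0 < ν (B ×ˢ Set.univ)

attribute [instance] LongDendron.met LongDendron.meas LongDendron.borelSpace

/-- `d_D((u,a),(v,b)) = d(u,v) + a + b`. -/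
def LongDendron.dD (D : LongDendron) (x y : D.carrier × ℝ≥0) : ℝ :=
  dist x.1 y.1 + (x.2 : ℝ) + (y.2 : ℝ)

/-- `τ_r(D)` for a long dendron `D`. -/
def LongDendron.samp (D : LongDendron) (r : ℕ) :
    MeasureTheory.Measure (Fin r → Fin r → ℝ) :=
  samplingMeasure D.dD r D.ν

/-- A dendron: a long dendron with `d_D ≤ 1` `ν²`-almost surely. -/
def LongDendron.IsDendron (D : LongDendron) : Prop :=
  (D.ν.prod D.ν) {x : (D.carrier × ℝ≥0) × (D.carrier × ℝ≥0) | 1 < D.dD x.1 x.2} = 0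

/-- The (combinatorial) diameter of a finite graph. -/
def graphDiam {V : Type*} [Fintype V] (G : SimpleGraph V) : ℕ :=
  Finset.sup Finset.univ fun p : V × V => G.dist p.1 p.2

/-- The shortest path distance normalized by the diameter. -/
def treeDist {V : Type*} [Fintype V] (G : SimpleGraph V) (u v : V) : ℝ :=
  (G.dist u v : ℝ) / (graphDiam G : ℝ)

/-- `τ_r(T)` for a finite tree: sampling from the uniform measure on the vertex set
with the normalized distance. -/
def treeSamp {V : Type*} [Fintype V] (G : SimpleGraph V) (r : ℕ) :
    MeasureTheory.Measure (Fin r → Fin r → ℝ) :=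
  @samplingMeasure V ⊤ (treeDist G) r
    ((Fintype.card V : ℝ≥0∞)⁻¹ • @MeasureTheory.Measure.count V ⊤)

/-- `(T,d,μ)` is an `A`-tree. -/
def IsATree {T : Type*} [MetricSpace T] [MeasurableSpace T] (n : ℕ)
    (A : Fin n → Fin n → ℝ) (μ : MeasureTheory.Measure T) : Prop :=
  ∃ q : Fin n → T,
    (∀ i j : Fin n, (if i = j then (0 : ℝ) else dist (q i) (q j)) = A i j) ∧
    (∀ Y : Set T, IsSubtree Y → (∀ i, q i ∈ Y) → Y = Set.univ) ∧
    (∀ H : Set T, MeasurableSet H →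
      μ H = ({i : Fin n | q i ∈ H}.ncard : ℝ≥0∞) / (n : ℝ≥0∞))

end

noncomputable section

/-- The associated projection `α(p) = (π(p), d(p, π(p)))` into `Core(T) × [0,∞)`,
for a given nearest-point retraction `π` onto the core. -/
def assocProj {T : Type*} [MetricSpace T] [MeasurableSpace T]
    (μ : MeasureTheory.Measure T) (π : T → T) (hπ : ∀ t, π t ∈ treeCore μ) :
    T → ↥(treeCore μ) × ℝ≥0 :=
  fun p => (⟨π p, hπ p⟩, ⟨dist p (π p), dist_nonneg⟩)

/-- The Borel σ-algebra on `Core(T) × [0,∞)` (the core carrying the restricted metric). -/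
def coreBorel {T : Type*} [MetricSpace T] [MeasurableSpace T]
    (μ : MeasureTheory.Measure T) : MeasurableSpace (↥(treeCore μ) × ℝ≥0) :=
  borel _

/-- The measure of the associated long dendron: push-forward of `μ` along the
associated projection. -/
def assocNu {T : Type*} [MetricSpace T] [MeasurableSpace T]
    (μ : MeasureTheory.Measure T) (π : T → T) (hπ : ∀ t, π t ∈ treeCore μ) :
    @MeasureTheory.Measure (↥(treeCore μ) × ℝ≥0) (coreBorel μ) :=
  letI : MeasurableSpace (↥(treeCore μ) × ℝ≥0) := coreBorel μ
  MeasureTheory.Measure.map (assocProj μ π hπ) μ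

/-- `d_D` for the associated long dendron of a semi-measured real tree. -/
def coreDD {T : Type*} [MetricSpace T] [MeasurableSpace T]
    (μ : MeasureTheory.Measure T) (x y : ↥(treeCore μ) × ℝ≥0) : ℝ :=
  dist (x.1 : T) (y.1 : T) + (x.2 : ℝ) + (y.2 : ℝ)

end

open MeasureTheory Metric Filter Topology Set
open scoped NNReal ENNReal

noncomputable section


namespace RT

def Btw {T : Type} [MetricSpace T] (x z y : T) : Prop := dist x z + dist z y = dist x y

def Same {T : Type} [MetricSpace T] (p x y : T) : Prop := y ∈ connectedComponentIn ({p}ᶜ) x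

section
variable {T : Type} [MetricSpace T]

lemma Btw.symm {x z y : T} (h : Btw x z y) : Btw y z x := by
  unfold Btw at *
  rw [dist_comm y z, dist_comm z x, dist_comm y x]; linarith

lemma Same.ne_right {p x y : T} (h : Same p x y) : y ≠ p := by
  have := connectedComponentIn_subset _ _ h
  simpa using this

lemma Same.ne_left {p x y : T} (h : Same p x y) : x ≠ p := by
  rintro rfl
  unfold Same at h
  rw [connectedComponentIn_eq_empty (by simp)] at h
  exact h

lemma Same.symm {p x y : T} (h : Same p x y) : Same p y x := by
  have h1 := h.ne_left
  have h2 := connectedComponentIn_eq h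
  unfold Same
  rw [← h2]
  exact mem_connectedComponentIn (by simpa using h1)

lemma Same.trans {p x y z : T} (h : Same p x y) (h' : Same p y z) : Same p x z := by
  have h2 := connectedComponentIn_eq h
  unfold Same at *
  rwa [h2]

lemma seg (hT : IsRealTree T) (x y : T) : ∃ α : ℝ → T, 
    (∀ s ∈ Icc 0 (dist x y), ∀ t ∈ Icc 0 (dist x y), dist (α s) (α t) = |s - t|) ∧
    α 0 = x ∧ α (dist x y) = y ∧ ∀ c, 0 < c → c < dist x y → ¬ Same (α c) x y := by
  by_cases hxy : x = y
  · subst hxy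
    refine ⟨fun _ => x, ?_, rfl, rfl, ?_⟩
    · intro s hs t ht
      simp only [dist_self, Icc_self, mem_singleton_iff] at hs ht
      simp [hs, ht]
    · intro c h1 h2
      simp at h2; linarith
  · obtain ⟨a, b, hab, α, h1, h2, h3, h4⟩ := hT.2.2 x y hxy
    have hd : dist x y = b - a := by
      rw [← h2, ← h3, h1 a (by simp [hab.le]) b (by simp [hab.le]), abs_sub_comm, abs_of_pos (by linarith)]
    refine ⟨fun t => α (a + t), ?_, by simpa using h2, by simp [hd, h3], ?_⟩
    · intro s hs t ht
      rw [hd] at hs ht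
      simp only [mem_Icc] at hs ht
      show dist (α (a+s)) (α (a+t)) = _
      rw [h1 (a+s) (by simp only [mem_Icc]; constructor <;> linarith) (a+t) (by simp only [mem_Icc]; constructor <;> linarith)]
      congr 1; ring
    · intro c hc hc' h
      exact h4 (a+c) (by linarith) (by linarith) (connectedComponentIn_eq h)

lemma geo (hT : IsRealTree T) (x y : T) (t : ℝ) (h0 : 0 ≤ t) (h1 : t ≤ dist x y) :
    ∃ z, dist x z = t ∧ Btw x z y := by
  obtain ⟨α, h, ha, hb, -⟩ := seg hT x y
  have e1 : dist x (α t) = t := by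
    have := h 0 (by simp) t ⟨h0, h1⟩
    rw [ha] at this
    rw [this, abs_sub_comm, abs_of_nonneg (by linarith)]; ring
  have e2 : dist (α t) y = dist x y - t := by
    have := h t ⟨h0, h1⟩ (dist x y) (by simp)
    rw [hb] at this
    rw [this, abs_sub_comm, abs_of_nonneg (by linarith)]
  exact ⟨α t, e1, by unfold Btw; linarith⟩

lemma segConn (hT : IsRealTree T) (x y : T) :
    ∃ S : Set T, IsPreconnected S ∧ x ∈ S ∧ y ∈ S ∧ ∀ z ∈ S, Btw x z y := by
  obtain ⟨α, h, ha, hb, -⟩ := seg hT x y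
  refine ⟨α '' Icc 0 (dist x y), ?_, ⟨0, by simp, ha⟩, ⟨dist x y, by simp, hb⟩, ?_⟩
  · apply isPreconnected_Icc.image
    have : LipschitzOnWith 1 α (Icc 0 (dist x y)) := by
      apply LipschitzOnWith.of_dist_le_mul
      intro s hs t ht
      rw [h s hs t ht, Real.dist_eq]; simp
    exact this.continuousOn
  · rintro z ⟨t, ht, rfl⟩
    have e1 := h 0 (by simp) t ht
    have e2 := h t ht (dist x y) (by simp)
    rw [ha, abs_sub_comm, abs_of_nonneg (by linarith [ht.1])] at e1
    rw [hb, abs_sub_comm, abs_of_nonneg (by linarith [ht.2])] at e2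
    unfold Btw; linarith

lemma same_of_not_btw (hT : IsRealTree T) {x p y : T} (h : ¬ Btw x p y) : Same p x y := by
  obtain ⟨S, hS, hx, hy, hb⟩ := segConn hT x y
  refine hS.subset_connectedComponentIn hx ?_ hy
  intro z hz hzp
  rw [mem_singleton_iff] at hzp
  subst hzp
  exact h (hb z hz)

lemma not_same_of_btw (hT : IsRealTree T) {x p y : T} (h : Btw x p y) : ¬ Same p x y := by
  intro hs
  have hxp := hs.ne_left
  have hyp := hs.ne_right
  have h1 := dist_pos.2 hxp
  have h2 := dist_pos.2 hyp.symm
  obtain ⟨α, hα, ha, hb, hc⟩ := seg hT x y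
  have hd : dist x p < dist x y := by unfold Btw at h; linarith
  have e := hα 0 (by simp) (dist x p) ⟨h1.le, hd.le⟩
  rw [ha, abs_sub_comm, abs_of_nonneg (by linarith)] at e
  have hn := hc (dist x p) h1 hd
  set c := α (dist x p)
  by_cases hcp : c = p
  · rw [hcp] at hn; exact hn hs
  · apply hn
    have key : Same c x p := by
      apply same_of_not_btw hT
      intro hB
      unfold Btw at hB
      have : dist c p = 0 := by linarith
      exact hcp (dist_eq_zero.1 this)
    refine key.trans (same_of_not_btw hT ?_)
    intro hB
    unfold Btw at hB h
    have t := dist_triangle x c y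
    have : dist p c = 0 := by linarith [dist_nonneg (x := p) (y := c)]
    exact hcp (dist_eq_zero.1 this).symm

lemma same_common (hT : IsRealTree T) {p x y : T} (h : Same p x y) :
    ∃ δ > 0, ∀ z, 0 < dist p z → dist p z < δ → Btw p z x → Btw p z y := by
  have hn : ¬ Btw x p y := fun hb => not_same_of_btw hT hb h
  refine ⟨(dist x p + dist p y - dist x y) / 2, ?_, ?_⟩
  · have := dist_triangle x p y
    have : dist x p + dist p y ≠ dist x y := hn
    have : dist x y < dist x p + dist p y := lt_of_le_of_ne (by assumption) this.symm
    linarith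
  · intro z hz0 hz hzx
    by_contra hc
    have s1 : Same z p y := same_of_not_btw hT hc
    have s2 : ¬ Same z p x := not_same_of_btw hT hzx
    have s3 : Btw x z y := by
      by_contra hh
      exact s2 (s1.trans (same_of_not_btw hT hh).symm)
    unfold Btw at s3 hzx
    have := dist_triangle p z y
    rw [dist_comm x z] at s3
    rw [dist_comm x p] at hz
    linarith

lemma exists_seq (hT : IsRealTree T) {p x : T} (h : x ≠ p) :
    ∃ z : ℕ → T, (∀ k, 0 < dist p (z k) ∧ Btw p (z k) x ∧ Same p (z k) x) ∧ 
      ∀ y, Same p x y → ∃ k, Btw p (z k) y := by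
  have hd := dist_pos.2 h.symm
  have : ∀ k : ℕ, ∃ z, dist p z = dist p x / ((k:ℝ) + 1) ∧ Btw p z x := fun k =>
    geo hT p x _ (by positivity) (by apply div_le_self hd.le; linarith [Nat.cast_nonneg (α := ℝ) k])
  choose z hz1 hz2 using this
  have hpos : ∀ k, 0 < dist p (z k) := fun k => by rw [hz1]; positivity
  refine ⟨z, fun k => ⟨hpos k, hz2 k, ?_⟩, ?_⟩
  · apply same_of_not_btw hT
    intro hB
    have h1 := hz2 k
    have h2 := hpos k
    unfold Btw at hB h1
    rw [dist_comm (z k) p] at hB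
    linarith
  · intro y hy
    obtain ⟨δ, hδ, H⟩ := same_common hT hy
    obtain ⟨k, hk⟩ := exists_nat_gt (dist p x / δ)
    refine ⟨k, H _ (hpos k) ?_ (hz2 k)⟩
    rw [hz1, div_lt_iff₀ (by positivity)]
    rw [div_lt_iff₀ hδ] at hk
    nlinarith

lemma branch_meas [MeasurableSpace T] (hT : IsRealTree T) 
    (hballs : ∀ (x : T) (s : ℝ), MeasurableSet (Metric.ball x s)) {p : T} {B : Set T}
    (hB : IsBranchAt p B) : MeasurableSet B := by
  obtain ⟨x, hx, rfl⟩ := hB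
  obtain ⟨z, hz, hz'⟩ := exists_seq hT hx
  have hm : ∀ q : T, Measurable (fun y : T => dist y q) := fun q =>
    measurable_of_Iio fun s => hballs q s
  have : connectedComponentIn ({p}ᶜ) x = ⋃ k, {y | dist y (z k) < dist y p} := by
    ext y
    simp only [mem_iUnion, mem_setOf_eq]
    constructor
    · intro hy
      obtain ⟨k, hk⟩ := hz' y hy
      refine ⟨k, ?_⟩
      have := (hz k).1
      unfold Btw at hk
      rw [dist_comm y, dist_comm y]; linarith
    · rintro ⟨k, hk⟩
      refine (hz k).2.2.symm.trans (Same.symm (same_of_not_btw hT ?_))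
      intro hB
      unfold Btw at hB
      linarith [(hz k).1]
  rw [this]
  exact MeasurableSet.iUnion fun k => measurableSet_lt (hm _) (hm _)

lemma inner_mem [MeasurableSpace T] (hT : IsRealTree T) (μ : Measure T) [IsProbabilityMeasure μ]
    {z q : T} {B : Set T} (hB : IsBranchAt z B) (h1 : μ B = 1) (hq : IsInnerPoint μ q) : q ∈ B := by
  by_contra hqB
  by_cases hqz : q = z
  · subst hqz; exact hq ⟨B, hB, h1⟩
  apply hq
  refine ⟨connectedComponentIn ({q}ᶜ) z, ⟨z, Ne.symm hqz, rfl⟩, le_antisymm prob_le_one ?_⟩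
  rw [← h1]
  apply measure_mono
  obtain ⟨x, hx, rfl⟩ := hB
  intro b hb
  have hb' : Same z x b := hb
  have s1 : Btw b z q := by
    by_contra hh
    exact hqB (hb'.trans (same_of_not_btw hT hh))
  apply same_of_not_btw hT
  intro hB
  have := dist_pos.2 hqz
  have h2 := hB.symm
  unfold Btw at s1 h2
  rw [dist_comm q z] at *
  linarith

lemma branch_ball (hT : IsRealTree T) {p x c y : T} (h : Same p x c) (hy : dist y c < dist c p) :
    Same p x y := by
  refine h.trans (same_of_not_btw hT ?_)
  intro hB
  unfold Btw at hB
  rw [dist_comm y c] at hy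
  linarith [dist_nonneg (x := p) (y := y)]

/-- a branch without inner points misses the core -/
lemma core_disj [MeasurableSpace T] (hT : IsRealTree T) (μ : Measure T) {p x : T}
    (h : ∀ q, IsInnerPoint μ q → ¬ Same p x q) : ∀ q ∈ treeCore μ, ¬ Same p x q := by
  intro q hq hs
  obtain ⟨c, hc, hd⟩ := Metric.mem_closure_iff.1 hq (dist q p) (dist_pos.2 hs.ne_right)
  rw [dist_comm] at hd
  exact h c hc (branch_ball hT hs hd)

lemma feather_eq [MeasurableSpace T] (μ : Measure T) {p x : T} (hp : p ∈ treeCore μ)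
    (hx : x ≠ p) (h : ∀ q ∈ treeCore μ, ¬ Same p x q) :
    connectedComponentIn ((treeCore μ)ᶜ) x = connectedComponentIn ({p}ᶜ) x := by
  apply Subset.antisymm
  · apply connectedComponentIn_mono
    simpa using hp
  · apply isPreconnected_connectedComponentIn.subset_connectedComponentIn
    · exact mem_connectedComponentIn (by simpa using hx)
    · intro y hy hc
      exact h y hc hy

lemma proj_disj [MeasurableSpace T] (hT : IsRealTree T) (μ : Measure T) [IsProbabilityMeasure μ]
    {p x : T} (hp : p ∈ treeCore μ)
    (hpi : ∀ y ∈ treeCore μ, dist x p ≤ dist x y) : ∀ q ∈ treeCore μ, ¬ Same p x q := by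
  apply core_disj hT
  intro c hc hs
  obtain ⟨z, hz, hz'⟩ := exists_seq hT hs.ne_left
  obtain ⟨k, hk⟩ := hz' c hs
  obtain ⟨h0, hb, -⟩ := hz k
  generalize z k = w at *
  have hw : IsInnerPoint μ w := by
    by_contra hn
    have hn := not_not.1 hn
    obtain ⟨B, hB, h1⟩ := hn
    have hcB := inner_mem hT μ hB h1 hc
    obtain ⟨c', hc', hd⟩ := Metric.mem_closure_iff.1 hp (dist p w) h0
    have hc'B := inner_mem hT μ hB h1 hc'
    obtain ⟨u, hu, rfl⟩ := hB
    have s1 : Same w p c' := by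
      apply same_of_not_btw hT
      intro hB
      unfold Btw at hB
      linarith [dist_nonneg (x := w) (y := c')]
    have a : Same w u c := hcB
    have b : Same w u c' := hc'B
    exact not_same_of_btw hT hk (s1.trans (b.symm.trans a))
  have := hpi w (subset_closure hw)
  unfold Btw at hb
  rw [dist_comm x, dist_comm x] at this
  linarith

lemma null_of_disj [MeasurableSpace T] (hT : IsRealTree T) (μ : Measure T) [IsProbabilityMeasure μ]
    (hballs : ∀ (x : T) (s : ℝ), MeasurableSet (Metric.ball x s))
    {p x : T} (hp : p ∈ treeCore μ) (hx : x ≠ p)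
    (h : ∀ q ∈ treeCore μ, ¬ Same p x q) : μ (connectedComponentIn ({p}ᶜ) x) = 0 := by
  obtain ⟨c, hc⟩ : ∃ c, IsInnerPoint μ c := closure_nonempty_iff.1 ⟨p, hp⟩
  obtain ⟨z, hz, hz'⟩ := exists_seq hT hx
  have key : ∀ k, μ (connectedComponentIn ({z k}ᶜ) p)ᶜ = 0 := by
    intro k
    obtain ⟨h0, hb, hs⟩ := hz k
    have hni : ¬ IsInnerPoint μ (z k) := fun hi => h _ (subset_closure hi) hs.symm
    obtain ⟨B, hB, h1⟩ := not_not.1 hni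
    have hm := branch_meas hT hballs hB
    have hcB := inner_mem hT μ hB h1 hc
    have hcp : Btw (z k) p c := by
      by_contra hh
      exact h c (subset_closure hc) (hs.symm.trans (same_of_not_btw hT hh))
    have s : Same (z k) c p := by
      apply same_of_not_btw hT
      intro hB
      have hB := hB.symm
      unfold Btw at hB hcp
      rw [dist_comm (z k) p] at hcp
      linarith
    have : connectedComponentIn ({z k}ᶜ) p = B := by
      obtain ⟨u, hu, rfl⟩ := hB
      exact (connectedComponentIn_eq (Same.trans hcB s : Same (z k) u p)).symm
    rw [this]
    exact (prob_compl_eq_zero_iff hm).2 h1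
  refine measure_mono_null ?_ (measure_iUnion_null key)
  intro y hy
  obtain ⟨k, hk⟩ := hz' y hy
  exact mem_iUnion.2 ⟨k, not_same_of_btw hT hk⟩

end
end RT

open RT

/-- The feathers of a semi-measured real tree are exactly the measure-zero
`p`-branches over core points `p`, and `d(x,y) = d_D(α(x),α(y))` unless `x` and `y`
lie in the same feather. -/
theorem statement13 {T : Type} [MetricSpace T] [m : MeasurableSpace T]
    (hT : IsRealTree T) (μ : Measure T) [IsProbabilityMeasure μ]
    (hballs : ∀ (x : T) (s : ℝ), MeasurableSet (Metric.ball x s))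
    (π : T → T) (hπY : ∀ t, π t ∈ treeCore μ)
    (hπ : ∀ t, ∀ y ∈ treeCore μ, dist t (π t) ≤ dist t y) :
    (∀ F : Set T, IsFeather μ F ↔ ∃ p ∈ treeCore μ, IsBranchAt p F ∧ μ F = 0) ∧
    ∀ x y : T, ¬ (∃ F : Set T, IsFeather μ F ∧ x ∈ F ∧ y ∈ F) →
      dist x y = dist (π x) (π y) + dist x (π x) + dist y (π y) := by
  have hpx : ∀ x, x ∉ treeCore μ → x ≠ π x := fun x hx h => hx (h ▸ hπY x)
  have hdis : ∀ x, ∀ q ∈ treeCore μ, ¬ Same (π x) x q := fun x =>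
    proj_disj hT μ (hπY x) (hπ x)
  have hadd : ∀ x, ∀ y ∈ treeCore μ, dist x (π x) + dist (π x) y = dist x y := by
    intro x y hy
    by_contra hh
    exact hdis x y hy (same_of_not_btw hT hh)
  refine ⟨fun F => ⟨?_, ?_⟩, ?_⟩
  · rintro ⟨x, hx, rfl⟩
    have hne := hpx x hx
    have e := feather_eq μ (hπY x) hne (hdis x)
    refine ⟨π x, hπY x, ⟨x, hne, e⟩, ?_⟩
    rw [e]
    exact null_of_disj hT μ hballs (hπY x) hne (hdis x)
  · rintro ⟨p, hp, ⟨x, hx, rfl⟩, h0⟩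
    have hd : ∀ q ∈ treeCore μ, ¬ Same p x q := by
      apply core_disj hT
      intro q hq hs
      apply hq
      have hB : IsBranchAt p (connectedComponentIn ({p}ᶜ) x) := ⟨x, hx, rfl⟩
      refine ⟨connectedComponentIn ({q}ᶜ) p, ⟨p, hs.ne_right.symm, rfl⟩,
        le_antisymm prob_le_one ?_⟩
      rw [← (prob_compl_eq_one_iff (branch_meas hT hballs hB)).2 h0]
      apply measure_mono
      intro y hy
      have s1 : RT.Btw q p y := by
        by_contra hh
        exact hy (hs.trans (same_of_not_btw hT hh))
      apply same_of_not_btw hT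
      intro hb
      have := dist_pos.2 hs.ne_right
      unfold RT.Btw at hb s1
      rw [dist_comm p q] at hb
      linarith
    refine ⟨x, fun hxc => hd x hxc ?_, (feather_eq μ hp hx hd).symm⟩
    exact mem_connectedComponentIn (by simpa using hx)
  · intro x y hxy
    have h1 : dist x (π x) + dist (π x) y = dist x y := by
      by_contra hh
      have s : Same (π x) x y := same_of_not_btw hT hh
      have hx : x ∉ treeCore μ := by
        intro hx
        have h2 := hπ x x hx
        rw [dist_self] at h2
        exact s.ne_left (dist_le_zero.1 h2)
      apply hxy
      refine ⟨_, ⟨x, hx, rfl⟩, mem_connectedComponentIn hx, ?_⟩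
      rw [feather_eq μ (hπY x) (hpx x hx) (hdis x)]
      exact s
    have h2 := hadd y (π x) (hπY x)
    rw [dist_comm (π y), dist_comm y (π x)] at h2
    linarith

end
end

section
/- Let (T,d,μ) be a quasi measured real tree and let D be its associated long dendron. Then τ_r(T,d,μ) = τ_r(D) for every integer r ≥ 1. -/
open scoped NNReal ENNReal

open MeasureTheory Metric Filter Topology Set
open scoped NNReal ENNReal

noncomputable section

/-- Metric betweenness. -/
def MBtw {T : Type*} [MetricSpace T] (x c y : T) : Prop := dist x c + dist c y = dist x y

lemma MBtw.symm {T : Type*} [MetricSpace T] {x c y : T} (h : MBtw x c y) : MBtw y c x := by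
  unfold MBtw at *
  rw [dist_comm y c, dist_comm c x, dist_comm y x]; linarith

/-- Existence of geodesics, all of whose interior points separate. -/
lemma tree_geod {T : Type*} [MetricSpace T] (hT : IsRealTree T) (p q : T) :
    ∃ γ : ℝ → T, (∀ s ∈ Set.Icc 0 (dist p q), ∀ t ∈ Set.Icc 0 (dist p q),
      dist (γ s) (γ t) = |s - t|) ∧ γ 0 = p ∧ γ (dist p q) = q ∧
      ∀ c, 0 < c → c < dist p q →
        connectedComponentIn ({γ c}ᶜ) p ≠ connectedComponentIn ({γ c}ᶜ) q := by
  by_cases hpq : p = q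
  · subst hpq
    refine ⟨fun _ => p, ?_, rfl, rfl, ?_⟩
    · intro s hs t ht
      simp only [dist_self, Icc_self, mem_singleton_iff] at hs ht
      simp [hs, ht]
    · intro c h1 h2
      simp at h2; linarith
  · obtain ⟨a, b, hab, α, hiso, ha, hb, hsep⟩ := hT.2.2 p q hpq
    have hd : dist p q = b - a := by
      rw [← ha, ← hb, hiso a ⟨le_rfl, hab.le⟩ b ⟨hab.le, le_rfl⟩, abs_sub_comm, abs_of_pos]
      linarith
    refine ⟨fun s => α (a + s), ?_, by simpa using ha, by simp [hd, hb], ?_⟩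
    · intro s hs t ht
      rw [hd] at hs ht
      rw [hiso _ ⟨by linarith [hs.1], by linarith [hs.2]⟩ _ ⟨by linarith [ht.1], by linarith [ht.2]⟩]
      congr 1; ring
    · intro c h1 h2
      exact hsep _ (by linarith) (by linarith)

/-- If `c` is not between `x` and `y` then they are in the same component. -/
lemma comp_of_not_btw {T : Type*} [MetricSpace T] (hT : IsRealTree T) {x c y : T}
    (h : ¬ MBtw x c y) : y ∈ connectedComponentIn ({c}ᶜ) x := by
  obtain ⟨γ, hiso, h0, h1, -⟩ := tree_geod hT x y
  have hz : (0:ℝ) ∈ Set.Icc 0 (dist x y) := ⟨le_rfl, dist_nonneg⟩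
  have ho : dist x y ∈ Set.Icc 0 (dist x y) := ⟨dist_nonneg, le_rfl⟩
  have hcont : ContinuousOn γ (Set.Icc 0 (dist x y)) := by
    rw [Metric.continuousOn_iff]
    intro b hb ε hε
    refine ⟨ε, hε, fun a ha hab => ?_⟩
    rw [hiso a ha b hb]; exact hab
  have hpc : IsPreconnected (γ '' Set.Icc 0 (dist x y)) := isPreconnected_Icc.image _ hcont
  refine hpc.subset_connectedComponentIn ⟨0, hz, h0⟩ ?_ ⟨_, ho, h1⟩
  rintro _ ⟨s, hs, rfl⟩ hsc
  apply h
  rw [mem_singleton_iff] at hsc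
  unfold MBtw
  have e1 := hiso 0 hz s hs
  have e2 := hiso s hs _ ho
  rw [h0, hsc] at e1
  rw [h1, hsc] at e2
  rw [e1, e2, abs_of_nonpos (by linarith [hs.1]), abs_of_nonpos (by linarith [hs.2])]
  ring

lemma tree_point {T : Type*} [MetricSpace T] (hT : IsRealTree T) (p q : T) (s : ℝ)
    (h0 : 0 ≤ s) (h1 : s ≤ dist p q) : ∃ m, dist p m = s ∧ MBtw p m q := by
  obtain ⟨γ, hiso, g0, g1, -⟩ := tree_geod hT p q
  have hz : (0:ℝ) ∈ Set.Icc 0 (dist p q) := ⟨le_rfl, dist_nonneg⟩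
  have ho : dist p q ∈ Set.Icc 0 (dist p q) := ⟨dist_nonneg, le_rfl⟩
  have hs : s ∈ Set.Icc 0 (dist p q) := ⟨h0, h1⟩
  have e1 := hiso 0 hz s hs
  have e2 := hiso s hs _ ho
  rw [g0, zero_sub, abs_neg, abs_of_nonneg h0] at e1
  rw [g1, abs_sub_comm, abs_of_nonneg (by linarith)] at e2
  exact ⟨γ s, e1, by unfold MBtw; linarith⟩

lemma comp_ne_of_btw {T : Type*} [MetricSpace T] (hT : IsRealTree T) {x c y : T}
    (h : MBtw x c y) (hx : x ≠ c) (hy : y ≠ c) :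
    connectedComponentIn ({c}ᶜ) x ≠ connectedComponentIn ({c}ᶜ) y := by
  unfold MBtw at h
  obtain ⟨γ, hiso, g0, g1, hsep⟩ := tree_geod hT x y
  have px : 0 < dist x c := dist_pos.2 hx
  have py : 0 < dist c y := dist_pos.2 (Ne.symm hy)
  have hz : (0:ℝ) ∈ Set.Icc 0 (dist x y) := ⟨le_rfl, dist_nonneg⟩
  have ho : dist x y ∈ Set.Icc 0 (dist x y) := ⟨dist_nonneg, le_rfl⟩
  have hs : dist x c ∈ Set.Icc 0 (dist x y) := ⟨px.le, by linarith⟩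
  have e1 := hiso 0 hz _ hs
  have e2 := hiso _ hs _ ho
  rw [g0, zero_sub, abs_neg, abs_of_nonneg px.le] at e1
  rw [g1, abs_sub_comm, abs_of_nonneg (by linarith)] at e2
  have key := hsep (dist x c) px (by linarith)
  by_cases hm : γ (dist x c) = c
  · rwa [hm] at key
  · exfalso
    set m := γ (dist x c)
    apply key
    have pm : 0 < dist m c := dist_pos.2 hm
    have n1 : ¬ MBtw x m c := by unfold MBtw; intro hh; linarith
    have n2 : ¬ MBtw c m y := by
      unfold MBtw; intro hh; rw [dist_comm c m] at hh; linarith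
    exact (connectedComponentIn_eq (comp_of_not_btw hT n1)).trans
      (connectedComponentIn_eq (comp_of_not_btw hT n2))

/-- The branch of `x` at `c`. -/
lemma branch_eq {T : Type*} [MetricSpace T] (hT : IsRealTree T) {x c : T} (hx : x ≠ c) :
    connectedComponentIn ({c}ᶜ) x = {t | ¬ MBtw x c t} := by
  ext t
  constructor
  · intro ht hb
    have htc : t ≠ c := fun h => (connectedComponentIn_subset _ _ ht) h
    exact comp_ne_of_btw hT hb hx htc (connectedComponentIn_eq ht)
  · exact fun h => comp_of_not_btw hT h

lemma btw_or {T : Type*} [MetricSpace T] (hT : IsRealTree T) {x c z : T} (y : T)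
    (h : MBtw x c z) : MBtw x c y ∨ MBtw y c z := by
  by_contra hcon
  push Not at hcon
  have h1 := connectedComponentIn_eq (comp_of_not_btw hT hcon.1)
  have h2 := connectedComponentIn_eq (comp_of_not_btw hT hcon.2)
  have hx : x ≠ c := by rintro rfl; exact hcon.1 (by simp [MBtw])
  have hz : z ≠ c := by rintro rfl; exact hcon.2 (by simp [MBtw])
  exact comp_ne_of_btw hT h hx hz (h1.trans h2)

/-- Common initial segments. -/
lemma btw_germ {T : Type*} [MetricSpace T] (hT : IsRealTree T) {x c p : T} (y : T)
    (h : MBtw c p x) (hp : 2 * dist c p ≤ dist c x + dist c y - dist x y) : MBtw c p y := by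
  rcases btw_or hT y h with h1 | h1
  · exact h1
  · unfold MBtw at *
    have := dist_triangle c p y
    rw [dist_comm y p, dist_comm y x] at h1
    linarith

lemma btw_chain {T : Type*} [MetricSpace T] (hT : IsRealTree T) {x c e y : T}
    (h : MBtw x c e) (h' : MBtw c e y) (hne : c ≠ e) : MBtw x c y := by
  rcases btw_or hT y h with h1 | h1
  · exact h1
  · exfalso
    have := dist_pos.2 hne
    unfold MBtw at *
    rw [dist_comm y c, dist_comm y e] at h1
    linarith

section core
variable {T : Type*} [MetricSpace T] [MeasurableSpace T]

lemma meas_dist (hballs : ∀ (x : T) (s : ℝ), MeasurableSet (Metric.ball x s)) (x : T) :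
    Measurable (fun t => dist x t) := by
  refine measurable_of_Iio fun s => ?_
  convert hballs x s using 1
  ext t; simp [dist_comm]

lemma meas_btw (hballs : ∀ (x : T) (s : ℝ), MeasurableSet (Metric.ball x s)) (x c : T) :
    MeasurableSet {t | MBtw x c t} :=
  measurableSet_eq_fun ((meas_dist hballs c).const_add _) (meas_dist hballs x)

lemma not_inner (hT : IsRealTree T) (μ : Measure T) {p : T} :
    ¬ IsInnerPoint μ p ↔ ∃ x, x ≠ p ∧ μ {t | ¬ MBtw x p t} = 1 := by
  unfold IsInnerPoint IsBranchAt
  rw [not_not]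
  constructor
  · rintro ⟨B, ⟨x, hx, rfl⟩, hB⟩
    exact ⟨x, hx, by rw [← branch_eq hT hx]; exact hB⟩
  · rintro ⟨x, hx, h⟩
    exact ⟨_, ⟨x, hx, rfl⟩, by rw [branch_eq hT hx]; exact h⟩

lemma not_core (hT : IsRealTree T) (μ : Measure T) [IsProbabilityMeasure μ] {p : T}
    (hp : p ∉ treeCore μ) :
    ∃ x, μ {t | ¬ MBtw x p t} = 1 ∧ ∀ q ∈ treeCore μ, ¬ MBtw x p q := by
  have hpi : ¬ IsInnerPoint μ p := fun h => hp (subset_closure h)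
  obtain ⟨x, hx, hμ⟩ := (not_inner hT μ).1 hpi
  have inner : ∀ q, IsInnerPoint μ q → ¬ MBtw x p q := by
    intro q hq hb
    have hne : p ≠ q := by rintro rfl; exact hpi hq
    have hpos := dist_pos.2 hne
    have hsub : {t | ¬ MBtw x p t} ⊆ {t | ¬ MBtw p q t} := by
      intro t ht hb'
      rcases btw_or hT t hb with h1 | h1
      · exact ht h1
      · unfold MBtw at h1 hb'
        rw [dist_comm t p, dist_comm t q] at h1
        linarith
    refine (not_inner hT μ).2 ⟨p, hne, le_antisymm prob_le_one ?_⟩ hq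
    rw [← hμ]; exact measure_mono hsub
  refine ⟨x, hμ, fun q hq hb => ?_⟩
  have hne : p ≠ q := by rintro rfl; exact hp hq
  obtain ⟨q', hq', hd⟩ := Metric.mem_closure_iff.1 hq _ (dist_pos.2 hne)
  rcases btw_or hT q' hb with h1 | h1
  · exact inner q' hq' h1
  · unfold MBtw at h1
    rw [dist_comm q q'] at hd
    linarith [dist_nonneg (x := q') (y := p)]

lemma core_convex (hT : IsRealTree T) (μ : Measure T) [IsProbabilityMeasure μ] {p q q' : T}
    (hq : q ∈ treeCore μ) (hq' : q' ∈ treeCore μ) (h : MBtw q p q') : p ∈ treeCore μ := by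
  by_contra hp
  obtain ⟨x, -, hx⟩ := not_core hT μ hp
  rcases btw_or hT x h with h1 | h1
  · exact hx q hq h1.symm
  · exact hx q' hq' h1

lemma gate (hT : IsRealTree T) (μ : Measure T) [IsProbabilityMeasure μ]
    {π : T → T} (hπY : ∀ t, π t ∈ treeCore μ)
    (hπ : ∀ t, ∀ y ∈ treeCore μ, dist t (π t) ≤ dist t y) (y z : T) (hz : z ∈ treeCore μ) :
    MBtw y (π y) z := by
  by_contra hb
  set c := π y with hc
  have htri := dist_triangle y c z
  have hlt : dist y z < dist y c + dist c z := lt_of_le_of_ne htri (fun h => hb h.symm)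
  obtain ⟨p, hp1, hp2⟩ := tree_point hT c z ((dist c z + dist c y - dist z y) / 2)
    (by rw [dist_comm c y, dist_comm z y]; linarith)
    (by have := dist_triangle c z y; linarith)
  have hpc := core_convex hT μ (hπY y) hz hp2
  have hp3 := btw_germ hT y hp2 (by rw [hp1]; linarith)
  have := hπ y p hpc
  unfold MBtw at hp3
  rw [dist_comm y p, ← hc, dist_comm y c] at this
  rw [dist_comm y z, dist_comm y c] at hlt
  linarith

lemma section_null (hT : IsRealTree T) (μ : Measure T) [IsProbabilityMeasure μ]
    (hballs : ∀ (x : T) (s : ℝ), MeasurableSet (Metric.ball x s))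
    {π : T → T} (hπY : ∀ t, π t ∈ treeCore μ)
    (hπ : ∀ t, ∀ y ∈ treeCore μ, dist t (π t) ≤ dist t y) (x : T) :
    ∀ᵐ y ∂μ, MBtw x (π x) y := by
  set c := π x with hc
  by_cases hxc : x = c
  · refine Filter.Eventually.of_forall fun y => ?_
    rw [← hxc]; simp [MBtw]
  have hpos : 0 < dist c x := dist_pos.2 (Ne.symm hxc)
  have hex : ∀ n : ℕ, ∃ m, dist c m = dist c x / (n + 1) ∧ MBtw c m x := fun n =>
    tree_point hT c x _ (by positivity) (div_le_self hpos.le (by linarith [n.cast_nonneg (α := ℝ)]))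
  choose p hp1 hp2 using hex
  have hnull : ∀ n, ∀ᵐ y ∂μ, ¬ MBtw c (p n) y := by
    intro n
    have hppos : 0 < dist c (p n) := by rw [hp1]; positivity
    have hpn : p n ∉ treeCore μ := by
      intro h
      have h1 := hπ x _ h
      have h2 := hp2 n
      unfold MBtw at h2
      rw [← hc, dist_comm x c, dist_comm x] at h1
      linarith
    obtain ⟨x', hx', hco⟩ := not_core hT μ hpn
    have hae : ∀ᵐ y ∂μ, ¬ MBtw x' (p n) y :=
      (prob_compl_eq_zero_iff (meas_btw hballs x' (p n)).compl).2 hx'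
    filter_upwards [hae] with y hy hb
    rcases btw_or hT x' hb with h1 | h1
    · exact hco c (hπY x) h1.symm
    · exact hy h1
  filter_upwards [ae_all_iff.2 hnull] with y hy
  by_contra hb
  have hlt : dist x y < dist x c + dist c y :=
    lt_of_le_of_ne (dist_triangle x c y) (fun h => hb h.symm)
  obtain ⟨n, hn⟩ := exists_nat_gt (2 * dist c x / (dist x c + dist c y - dist x y))
  have hd : 0 < dist x c + dist c y - dist x y := by linarith
  apply hy n
  apply btw_germ hT y (hp2 n)
  rw [hp1]
  rw [div_lt_iff₀ hd] at hn
  rw [dist_comm x c] at hn hd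
  rw [mul_div_assoc', div_le_iff₀ (by positivity)]
  nlinarith

lemma dist_eq_of_btw (hT : IsRealTree T) (μ : Measure T) [IsProbabilityMeasure μ]
    {π : T → T} (hπY : ∀ t, π t ∈ treeCore μ)
    (hπ : ∀ t, ∀ y ∈ treeCore μ, dist t (π t) ≤ dist t y) {x y : T} (h : MBtw x (π x) y) :
    dist x y = dist (π x) (π y) + dist x (π x) + dist y (π y) := by
  have := gate hT μ hπY hπ y (π x) (hπY x)
  unfold MBtw at *
  rw [dist_comm (π y), dist_comm y (π x)] at this
  linarith

lemma inner_pos (hT : IsRealTree T) (μ : Measure T) [IsProbabilityMeasure μ]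
    (hballs : ∀ (x : T) (s : ℝ), MeasurableSet (Metric.ball x s)) (o : T) {p : T}
    (hp : IsInnerPoint μ p) : 0 < μ {t | MBtw o p t} := by
  rw [pos_iff_ne_zero]
  intro h0
  by_cases hop : o = p
  · subst hop
    have : {t | MBtw o o t} = Set.univ := by ext; simp [MBtw]
    rw [this] at h0; simp at h0
  · refine (not_inner hT μ).2 ⟨o, hop, ?_⟩ hp
    exact (prob_compl_eq_one_iff (meas_btw hballs o p)).2 h0

lemma sep_countable (hT : IsRealTree T) (μ : Measure T) [IsProbabilityMeasure μ]
    (hballs : ∀ (x : T) (s : ℝ), MeasurableSet (Metric.ball x s)) {ε : ℝ} (hε : 0 < ε)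
    {N : Set T} (hN : N ⊆ {p | IsInnerPoint μ p}) (hsep : N.Pairwise fun x y => ε ≤ dist x y) :
    N.Countable := by
  obtain ⟨o⟩ := hT.1
  have hcov : N = ⋃ k : ℤ, {p | p ∈ N ∧ ⌊dist o p / ε⌋ = k} := by ext; simp
  rw [hcov]
  refine countable_iUnion fun k => ?_
  set A := {p | p ∈ N ∧ ⌊dist o p / ε⌋ = k} with hA
  have key : ∀ p ∈ A, ∀ q ∈ A, dist o p ≤ dist o q → ∀ t, MBtw o p t → MBtw o q t → p = q := by
    intro p hp q hq hle t h1 h2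
    by_contra hne
    have hd := hsep hp.1 hq.1 hne
    have hfl : |dist o q / ε - dist o p / ε| < 1 :=
      Int.abs_sub_lt_one_of_floor_eq_floor (hq.2.trans hp.2.symm)
    rw [← sub_div, abs_of_nonneg (by apply div_nonneg <;> linarith), div_lt_one hε] at hfl
    rcases btw_or hT q h1 with h3 | h3
    · unfold MBtw at h3; linarith
    · unfold MBtw at *
      rw [dist_comm q p] at h3
      linarith
  have := Measure.countable_meas_pos_of_disjoint_iUnion (μ := μ)
    (As := fun p : A => {t | MBtw o (p : T) t}) (fun p => meas_btw hballs o p) (by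
      intro p q hpq
      rw [Function.onFun, Set.disjoint_left]
      intro t h1 h2
      apply hpq
      rcases le_total (dist o p) (dist o q) with h | h
      · exact Subtype.ext (key p p.2 q q.2 h t h1 h2)
      · exact Subtype.ext (key q q.2 p p.2 h t h2 h1).symm)
  have h2 : {i : A | 0 < μ {t | MBtw o (i : T) t}} = Set.univ := by
    ext i; simpa using inner_pos hT μ hballs o (hN i.2.1)
  rw [h2] at this
  exact Set.countable_coe_iff.1 (Set.countable_univ_iff.1 this)

lemma core_separable (hT : IsRealTree T) (μ : Measure T) [IsProbabilityMeasure μ]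
    (hballs : ∀ (x : T) (s : ℝ), MeasurableSet (Metric.ball x s)) :
    TopologicalSpace.IsSeparable (treeCore μ) := by
  apply TopologicalSpace.IsSeparable.closure
  have hex : ∀ n : ℕ, ∃ N ⊆ {p | IsInnerPoint μ p}, N.Countable ∧
      ∀ p, IsInnerPoint μ p → ∃ q ∈ N, dist p q < 1 / ((n : ℝ) + 1) := by
    intro n
    have hε : 0 < 1 / ((n : ℝ) + 1) := by positivity
    obtain ⟨N, hN⟩ := zorn_subset {N : Set T | N ⊆ {p | IsInnerPoint μ p} ∧
        N.Pairwise fun x y => 1 / ((n : ℝ) + 1) ≤ dist x y} (by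
      intro C hC hch
      refine ⟨⋃₀ C, ⟨sUnion_subset fun s hs => (hC hs).1, ?_⟩, fun s hs => subset_sUnion_of_mem hs⟩
      exact (pairwise_sUnion hch.directedOn).2 fun s hs => (hC hs).2)
    refine ⟨N, hN.prop.1, sep_countable hT μ hballs hε hN.prop.1 hN.prop.2, fun p hp => ?_⟩
    by_contra hcon
    push Not at hcon
    have hins : insert p N ∈ {N : Set T | N ⊆ {p | IsInnerPoint μ p} ∧
        N.Pairwise fun x y => 1 / ((n : ℝ) + 1) ≤ dist x y} := by
      refine ⟨insert_subset hp hN.prop.1, ?_⟩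
      refine hN.prop.2.insert fun b hb _ => ⟨hcon b hb, ?_⟩
      rw [dist_comm]; exact hcon b hb
    have hpN : p ∈ N := hN.le_of_ge hins (subset_insert p N) (mem_insert p N)
    have := hcon p hpN
    rw [dist_self] at this
    linarith
  choose N _ hNc hNd using hex
  refine ⟨⋃ n, N n, countable_iUnion hNc, fun p hp => ?_⟩
  rw [Metric.mem_closure_iff]
  intro ε hε
  obtain ⟨n, hn⟩ := exists_nat_one_div_lt hε
  obtain ⟨q, hq, hd⟩ := hNd n p hp
  exact ⟨q, mem_iUnion.2 ⟨n, hq⟩, hd.trans hn⟩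

end core

lemma ae_prod_of_sections {T : Type*} [MeasurableSpace T] (μ : Measure T) [IsProbabilityMeasure μ]
    {f g : T × T → ℝ} (hf : AEMeasurable f (μ.prod μ)) (hg : Measurable g)
    (h : ∀ x, ∀ᵐ y ∂μ, f (x, y) = g (x, y)) : f =ᵐ[μ.prod μ] g := by
  have h1 : f =ᵐ[μ.prod μ] hf.mk f := hf.ae_eq_mk
  refine h1.trans ?_
  refine (Measure.ae_prod_iff_ae_ae (measurableSet_eq_fun hf.measurable_mk hg)).2 ?_
  filter_upwards [Measure.ae_ae_of_ae_prod h1] with x hx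
  filter_upwards [hx, h x] with y h2 h3
  rw [← h2, h3]

lemma pi_pair {T : Type*} [MeasurableSpace T] (μ : Measure T) [IsProbabilityMeasure μ] {r : ℕ}
    {i j : Fin r} (hij : i ≠ j) :
    Measure.map (fun x : Fin r → T => (x i, x j)) (Measure.pi fun _ => μ) = μ.prod μ := by
  have h := (ProbabilityTheory.iIndepFun_pi (μ := fun _ : Fin r => μ) (X := fun _ (t : T) => t)
    (fun _ => aemeasurable_id')).indepFun hij
  have h2 := h.map_prod_eq_prod_map_map (measurable_pi_apply i).aemeasurable
    (measurable_pi_apply j).aemeasurable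
  rw [h2]
  have e : ∀ k : Fin r, Measure.map (fun x : Fin r → T => x k) (Measure.pi fun _ => μ) = μ :=
    fun k => (measurePreserving_eval (fun _ : Fin r => μ) k).map_eq
  rw [e, e]

lemma sampling_eq {T A : Type*} [MeasurableSpace T] [TopologicalSpace A]
    [SecondCountableTopology A] [MeasurableSpace A] [BorelSpace A]
    (μ : Measure T) [IsProbabilityMeasure μ] (d : T → T → ℝ) (dA : A → A → ℝ)
    (hd : AEMeasurable (fun p : T × T => d p.1 p.2) (μ.prod μ))
    (hdA : Continuous fun p : A × A => dA p.1 p.2)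
    (φ : T → A) (hφ : Measurable φ) (h : ∀ x, ∀ᵐ y ∂μ, d x y = dA (φ x) (φ y)) (r : ℕ) :
    samplingMeasure d r μ = samplingMeasure dA r (Measure.map φ μ) := by
  have hdAm : Measurable fun p : A × A => dA p.1 p.2 := hdA.measurable
  have hae := ae_prod_of_sections μ hd
    (hdAm.comp ((hφ.comp measurable_fst).prodMk (hφ.comp measurable_snd))) h
  have : IsProbabilityMeasure (Measure.map φ μ) := Measure.isProbabilityMeasure_map hφ.aemeasurable
  have hrho : Measurable (rho dA r) := by
    refine measurable_pi_lambda _ fun i => measurable_pi_lambda _ fun j => ?_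
    unfold rho
    by_cases hij : i = j
    · simp [hij]
    · simp only [hij, if_false]
      have hm : Measurable fun x : Fin r → A => (x i, x j) :=
        (measurable_pi_apply i).prodMk (measurable_pi_apply j)
      exact hdAm.comp hm
  unfold samplingMeasure
  rw [← Measure.pi_map_pi (μ := fun _ : Fin r => μ) (f := fun _ => φ) (fun _ => hφ.aemeasurable),
    Measure.map_map hrho (by fun_prop)]
  apply Measure.map_congr
  have hall : ∀ i j : Fin r, ∀ᵐ x ∂(Measure.pi fun _ : Fin r => μ),
      rho d r x i j = rho dA r (fun k => φ (x k)) i j := by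
    intro i j
    unfold rho
    by_cases hij : i = j
    · simp [hij]
    · simp only [hij, if_false]
      rw [← pi_pair μ hij] at hae
      exact ae_of_ae_map (by fun_prop) hae
  filter_upwards [ae_all_iff.2 fun i => ae_all_iff.2 (hall i)] with x hx
  ext i j
  exact hx i j

lemma measurable_of_dist {T Y : Type*} [MeasurableSpace T] [PseudoMetricSpace Y]
    [SecondCountableTopology Y] [MeasurableSpace Y] [BorelSpace Y] (f : T → Y)
    (h : ∀ z, Measurable fun t => dist (f t) z) : Measurable f := by
  refine measurable_of_isOpen fun U hU => ?_
  have hex : ∀ x : U, ∃ ε > 0, ball (x : Y) ε ⊆ U := fun x => Metric.isOpen_iff.1 hU x x.2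
  choose ε hε hsub using hex
  obtain ⟨S, hS, hSU⟩ := TopologicalSpace.isOpen_iUnion_countable
    (fun x : U => ball (x : Y) (ε x)) (fun _ => isOpen_ball)
  have hUeq : U = ⋃ x ∈ S, ball (x : Y) (ε x) := by
    rw [hSU]
    refine Subset.antisymm (fun x hx => mem_iUnion.2 ⟨⟨x, hx⟩, mem_ball_self (hε _)⟩)
      (iUnion_subset hsub)
  rw [hUeq]
  simp only [preimage_iUnion]
  exact MeasurableSet.biUnion hS fun x _ => measurableSet_lt (h x) measurable_const

lemma measurable_assocProj {T : Type*} [MetricSpace T] [MeasurableSpace T]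
    (hT : IsRealTree T) (μ : Measure T) [IsProbabilityMeasure μ]
    (hballs : ∀ (x : T) (s : ℝ), MeasurableSet (Metric.ball x s))
    (π : T → T) (hπY : ∀ t, π t ∈ treeCore μ)
    (hπ : ∀ t, ∀ y ∈ treeCore μ, dist t (π t) ≤ dist t y)
    [SecondCountableTopology (treeCore μ)] :
    @Measurable _ _ _ (coreBorel μ) (assocProj μ π hπY) := by
  have hdist : Measurable fun t => dist t (π t) := by
    have : (fun t => dist t (π t)) = fun t => infDist t (treeCore μ) := by
      ext t
      refine le_antisymm ((le_infDist ⟨_, hπY t⟩).2 fun {y} hy => hπ t y hy)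
        (infDist_le_dist_of_mem (hπY t))
    obtain ⟨o⟩ := hT.1
    have : Nonempty (treeCore μ) := ⟨⟨_, hπY o⟩⟩
    refine measurable_of_Iio fun s => ?_
    have e : (fun t => dist t (π t)) ⁻¹' Iio s =
        ⋃ n, ball ((TopologicalSpace.denseSeq (treeCore μ) n : treeCore μ) : T) s := by
      ext t
      simp only [mem_preimage, mem_Iio, mem_iUnion, mem_ball]
      constructor
      · intro h
        obtain ⟨_, hz, n, rfl⟩ := Metric.dense_iff.1 (TopologicalSpace.denseRange_denseSeq (treeCore μ))
          ⟨π t, hπY t⟩ (s - dist t (π t)) (by linarith)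
        refine ⟨n, ?_⟩
        rw [mem_ball, Subtype.dist_eq, dist_comm] at hz
        have := dist_triangle t (π t) (TopologicalSpace.denseSeq (treeCore μ) n : treeCore μ)
        simp only at hz
        linarith
      · rintro ⟨n, hn⟩
        exact (hπ t _ (Subtype.coe_prop _)).trans_lt hn
    rw [e]
    exact MeasurableSet.iUnion fun n => hballs _ _
  letI m1 : MeasurableSpace (treeCore μ) := borel _
  haveI : BorelSpace (treeCore μ) := ⟨rfl⟩
  have hcb : coreBorel μ = @Prod.instMeasurableSpace _ _ m1 _ := by
    unfold coreBorel
    exact (Prod.borelSpace (α := treeCore μ) (β := ℝ≥0)).measurable_eq.symm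
  rw [hcb]
  refine Measurable.prodMk ?_ hdist.subtype_mk
  refine measurable_of_dist _ fun z => ?_
  have e : (fun t => dist (⟨π t, hπY t⟩ : treeCore μ) z) =
      fun t => dist (z : T) t - dist t (π t) := by
    ext t
    have := gate hT μ hπY hπ t z z.2
    unfold MBtw at this
    rw [Subtype.dist_eq, dist_comm (z : T) t]
    simp only
    linarith
  rw [e]
  exact (meas_dist hballs z).sub hdist

/-- For a quasi measured real tree `(T,d,μ)` (the distance being `μ²`-measurable),
the sampling measures of `(T,d,μ)` and of its associated long dendron agree. -/
theorem statement14 {T : Type} [MetricSpace T] [m : MeasurableSpace T]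
    (hT : IsRealTree T) (μ : Measure T) [IsProbabilityMeasure μ]
    (hballs : ∀ (x : T) (s : ℝ), MeasurableSet (Metric.ball x s))
    (hquasi : AEMeasurable (fun p : T × T => dist p.1 p.2) (μ.prod μ))
    (π : T → T) (hπY : ∀ t, π t ∈ treeCore μ)
    (hπ : ∀ t, ∀ y ∈ treeCore μ, dist t (π t) ≤ dist t y)
    (r : ℕ) (hr : 1 ≤ r) :
    samplingMeasure (fun x y : T => dist x y) r μ =
      @samplingMeasure (↥(treeCore μ) × ℝ≥0) (coreBorel μ) (coreDD μ) r
        (assocNu μ π hπY) := by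
  haveI : SecondCountableTopology (treeCore μ) := by
    haveI := (core_separable hT μ hballs).separableSpace
    exact UniformSpace.secondCountable_of_separable _
  refine @sampling_eq T (↥(treeCore μ) × ℝ≥0) m _ _ (coreBorel μ) (@BorelSpace.mk _ _ (coreBorel μ) rfl)
    μ _ _ (coreDD μ) hquasi ?_ (assocProj μ π hπY)
    (measurable_assocProj hT μ hballs π hπY hπ) ?_ r
  · unfold coreDD
    fun_prop
  · intro x
    filter_upwards [section_null hT μ hballs hπY hπ x] with y hy
    exact dist_eq_of_btw hT μ hπY hπ hy

end
end

section
/- Let D = (T,d,ν) be a long dendron. Then the real tree (T,d) is separable; moreover it has a countable subset that is dense in every proper segment of T. Furthermore, for every ε > 0 there exist a compact subtree Y of T and a real number a > 0 such that ν(Y×[0,a]) > 1−ε. -/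
open scoped NNReal ENNReal

open MeasureTheory Metric Filter Topology Set
open scoped NNReal ENNReal

noncomputable section

theorem rt_seg {T : Type*} [MetricSpace T] (hT : IsRealTree T) (p q : T) :
    ∃ S : Set T, p ∈ S ∧ q ∈ S ∧ IsCompact S ∧ IsPreconnected S ∧
      (∀ w ∈ S, dist p w + dist w q = dist p q) ∧
      (∀ w ∈ S, ∀ w' ∈ S, dist p w = dist p w' → w = w') ∧
      (∀ c ∈ S, c ≠ p → c ≠ q →
        connectedComponentIn ({c}ᶜ) p ≠ connectedComponentIn ({c}ᶜ) q) := by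
  by_cases hpq : p = q
  · subst hpq
    refine ⟨{p}, rfl, rfl, isCompact_singleton, isPreconnected_singleton, ?_, ?_, ?_⟩
    · rintro w rfl; simp
    · rintro w rfl w' rfl _; rfl
    · rintro c rfl h; exact absurd rfl h
  · obtain ⟨a, b, hab, α, hα, ha, hb, hsep⟩ := hT.2.2 p q hpq
    have hcont : ContinuousOn α (Icc a b) := by
      have : LipschitzOnWith 1 α (Icc a b) := by
        apply LipschitzOnWith.of_dist_le_mul
        intro s hs t ht
        rw [hα s hs t ht, Real.dist_eq]; simp
      exact this.continuousOn
    have ha' : a ∈ Icc a b := ⟨le_rfl, hab.le⟩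
    have hb' : b ∈ Icc a b := ⟨hab.le, le_rfl⟩
    refine ⟨α '' Icc a b, ⟨a, ha', ha⟩, ⟨b, hb', hb⟩, isCompact_Icc.image_of_continuousOn hcont,
      isPreconnected_Icc.image _ hcont, ?_, ?_, ?_⟩
    · rintro _ ⟨s, hs, rfl⟩
      rw [← ha, ← hb, hα a ha' s hs, hα s hs b hb', hα a ha' b hb', abs_of_nonpos, abs_of_nonpos,
        abs_of_nonpos] <;> linarith [hs.1, hs.2]
    · rintro _ ⟨s, hs, rfl⟩ _ ⟨t, ht, rfl⟩ h
      rw [← ha, hα a ha' s hs, hα a ha' t ht, abs_of_nonpos (by linarith [hs.1]),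
        abs_of_nonpos (by linarith [ht.1])] at h
      rw [show s = t by linarith]
    · rintro _ ⟨s, hs, rfl⟩ h1 h2
      refine hsep s (lt_of_le_of_ne hs.1 ?_) (lt_of_le_of_ne hs.2 ?_)
      · rintro rfl; exact h1 ha
      · rintro rfl; exact h2 hb

theorem rt_locConn {T : Type*} [MetricSpace T] (hT : IsRealTree T) : LocallyConnectedSpace T := by
  refine locallyConnectedSpace_of_connected_bases (fun x r => ball x r) (fun _ r => 0 < r)
    (fun x => Metric.nhds_basis_ball) ?_
  intro x r hr
  refine isPreconnected_of_forall x ?_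
  intro y hy
  obtain ⟨S, h1, h2, -, h4, h5, -⟩ := rt_seg hT x y
  refine ⟨S, ?_, h1, h2, h4⟩
  intro w hw
  have := h5 w hw
  rw [mem_ball, dist_comm] at hy ⊢
  linarith [dist_nonneg (x := w) (y := y)]

theorem rt_branch_open {T : Type*} [MetricSpace T] (hT : IsRealTree T) (p : T) (B : Set T)
    (hB : IsBranchAt p B) : IsOpen B := by
  haveI := rt_locConn hT
  obtain ⟨x, -, rfl⟩ := hB
  exact isOpen_compl_singleton.connectedComponentIn

theorem rt_mem_of_branch {T : Type*} [MetricSpace T] (p o z : T) (B : Set T)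
    (hB : IsBranchAt p B) (ho : o ∉ B) (hz : z ∈ B) (S : Set T) (hS : IsPreconnected S)
    (h1 : o ∈ S) (h2 : z ∈ S) : p ∈ S := by
  by_contra hp
  obtain ⟨x, -, rfl⟩ := hB
  apply ho
  rw [connectedComponentIn_eq hz]
  refine hS.subset_connectedComponentIn h2 ?_ h1
  rintro w hw rfl
  exact hp hw

theorem rt_disj {T : Type*} [MetricSpace T] (hT : IsRealTree T) (o p q z : T)
    (h : dist o p = dist o q) (B C : Set T)
    (hB : IsBranchAt p B) (hC : IsBranchAt q C) (hoB : o ∉ B) (hoC : o ∉ C)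
    (hzB : z ∈ B) (hzC : z ∈ C) : p = q := by
  obtain ⟨S, h1, h2, -, h4, -, h6, -⟩ := rt_seg hT o z
  exact h6 p (rt_mem_of_branch p o z B hB hoB hzB S h4 h1 h2) q
    (rt_mem_of_branch q o z C hC hoC hzC S h4 h1 h2) h

/-- the countable set -/
def rtQ {T : Type*} [MetricSpace T] (o : T) : Set T :=
  ⋃ r : ℚ, {p : T | dist o p = r ∧ ∃ B, IsBranchAt p B ∧ o ∉ B}

theorem rtQ_countable (D : LongDendron) (o : D.carrier) : (rtQ o).Countable := by
  haveI := D.isProb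
  refine countable_iUnion fun r => ?_
  set P := {p : D.carrier | dist o p = r ∧ ∃ B, IsBranchAt p B ∧ o ∉ B} with hP
  choose! B hB using fun (p : D.carrier) (hp : p ∈ P) => hp.2
  have := Measure.countable_meas_pos_of_disjoint_iUnion (μ := D.ν)
    (As := fun p : P => (B p) ×ˢ (univ : Set ℝ≥0))
    (fun p => ((rt_branch_open D.isRealTree p.1 _ (hB p p.2).1).measurableSet).prod .univ) ?_
  · have h2 : {i : P | 0 < D.ν ((B i) ×ˢ (univ : Set ℝ≥0))} = univ := by
      ext i
      simp only [mem_setOf_eq, mem_univ, iff_true]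
      exact D.branch_pos _ ⟨i, (hB i i.2).1⟩
    rw [h2] at this
    exact countable_coe_iff.1 (countable_univ_iff.1 this)
  · intro p q hpq
    refine Set.disjoint_left.2 ?_
    rintro ⟨z, t⟩ hz hz'
    apply hpq
    apply Subtype.ext
    exact rt_disj D.isRealTree o p q z (p.2.1.trans q.2.1.symm) _ _ (hB p p.2).1 (hB q q.2).1
      (hB p p.2).2 (hB q q.2).2 hz.1 hz'.1

theorem rtQ_dense {T : Type*} [MetricSpace T] (hT : IsRealTree T) (o x y : T) (hxy : x ≠ y)
    (S : Set T) (hS : IsSegment x y S) : S ⊆ closure (rtQ o ∩ S) := by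
  obtain ⟨a, b, hab, α, hα, ha, hb, rfl, hsep⟩ := hS
  have hab' : a < b := by
    refine lt_of_le_of_ne hab ?_
    rintro rfl
    exact hxy (ha.symm.trans hb)
  have hcont : ContinuousOn α (Icc a b) := by
    have : LipschitzOnWith 1 α (Icc a b) := by
      apply LipschitzOnWith.of_dist_le_mul
      intro s hs t ht
      rw [hα s hs t ht, Real.dist_eq]; simp
    exact this.continuousOn
  have ha' : a ∈ Icc a b := ⟨le_rfl, hab⟩
  have hb' : b ∈ Icc a b := ⟨hab, le_rfl⟩
  have hinj : ∀ s ∈ Icc a b, ∀ t ∈ Icc a b, α s = α t → s = t := by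
    intro s hs t ht h
    have := hα s hs t ht
    rw [h, dist_self] at this
    linarith [abs_eq_zero.1 this.symm]
  -- branches avoiding o
  have hbr : ∀ c, a < c → c < b → ∃ B, IsBranchAt (α c) B ∧ o ∉ B ∧ (x ∈ B ∨ y ∈ B) := by
    intro c hc1 hc2
    have hc : c ∈ Icc a b := ⟨hc1.le, hc2.le⟩
    have hx : x ≠ α c := by
      rintro h; rw [← ha] at h; exact hc1.ne (hinj a ha' c hc h)
    have hy : y ≠ α c := by
      rintro h; rw [← hb] at h; exact hc2.ne' (hinj b hb' c hc h)
    by_cases ho : o ∈ connectedComponentIn ({α c}ᶜ) x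
    · refine ⟨_, ⟨y, hy, rfl⟩, ?_, Or.inr (mem_connectedComponentIn hy)⟩
      intro ho'
      exact hsep c hc1 hc2 ((connectedComponentIn_eq ho).trans (connectedComponentIn_eq ho').symm)
    · exact ⟨_, ⟨x, hx, rfl⟩, ho, Or.inl (mem_connectedComponentIn hx)⟩
  have key : ∀ u v, a ≤ u → u < v → v ≤ b → ∃ c, u < c ∧ c < v ∧ α c ∈ rtQ o := by
    intro u v hu huv hv
    obtain ⟨c1, h1, h1'⟩ := exists_between huv
    obtain ⟨c2, h2, h2'⟩ := exists_between h1'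
    obtain ⟨c3, h3, h3'⟩ := exists_between h2'
    have hne : ∃ s t, u < s ∧ s < t ∧ t < v ∧ dist o (α s) ≠ dist o (α t) := by
      by_contra hcon
      push Not at hcon
      obtain ⟨B1, i1, o1, m1⟩ := hbr c1 (by linarith) (by linarith)
      obtain ⟨B2, i2, o2, m2⟩ := hbr c2 (by linarith) (by linarith)
      obtain ⟨B3, i3, o3, m3⟩ := hbr c3 (by linarith) (by linarith)
      have e12 := hcon c1 c2 (by linarith) (by linarith) (by linarith)
      have e23 := hcon c2 c3 (by linarith) (by linarith) (by linarith)
      have M1 : c1 ∈ Icc a b := ⟨by linarith, by linarith⟩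
      have M2 : c2 ∈ Icc a b := ⟨by linarith, by linarith⟩
      have M3 : c3 ∈ Icc a b := ⟨by linarith, by linarith⟩
      have d12 : ∀ z, z ∈ B1 → z ∈ B2 → False := fun z hz hz' =>
        h2.ne (hinj _ M1 _ M2 (rt_disj hT o _ _ z e12 _ _ i1 i2 o1 o2 hz hz'))
      have d23 : ∀ z, z ∈ B2 → z ∈ B3 → False := fun z hz hz' =>
        h3.ne (hinj _ M2 _ M3 (rt_disj hT o _ _ z e23 _ _ i2 i3 o2 o3 hz hz'))
      have d13 : ∀ z, z ∈ B1 → z ∈ B3 → False := fun z hz hz' =>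
        (h2.trans h3).ne (hinj _ M1 _ M3 (rt_disj hT o _ _ z (e12.trans e23) _ _ i1 i3 o1 o3 hz hz'))
      have := d12 x; have := d23 x; have := d13 x
      have := d12 y; have := d23 y; have := d13 y
      tauto
    obtain ⟨s, t, hs, hst, ht, hne⟩ := hne
    have hf : ContinuousOn (fun c => dist o (α c)) (uIcc s t) := by
      rw [uIcc_of_le hst.le]
      exact (Continuous.comp_continuousOn (continuous_const.dist continuous_id) (hcont.mono (Icc_subset_Icc (by linarith) (by linarith))))
    have hiv := intermediate_value_uIcc hf
    have hr : ∃ r : ℚ, (r : ℝ) ∈ uIcc (dist o (α s)) (dist o (α t)) := by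
      rcases lt_or_gt_of_ne hne with h | h
      · obtain ⟨r, hr⟩ := exists_rat_btwn h
        exact ⟨r, by rw [uIcc_of_le h.le]; exact ⟨hr.1.le, hr.2.le⟩⟩
      · obtain ⟨r, hr⟩ := exists_rat_btwn h
        exact ⟨r, by rw [uIcc_of_ge h.le]; exact ⟨hr.1.le, hr.2.le⟩⟩
    obtain ⟨r, hr⟩ := hr
    obtain ⟨c, hc, hcr⟩ := hiv hr
    rw [uIcc_of_le hst.le] at hc
    have hc1 : u < c := by linarith [hc.1]
    have hc2 : c < v := by linarith [hc.2]
    obtain ⟨B, iB, oB, -⟩ := hbr c (by linarith) (by linarith)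
    exact ⟨c, hc1, hc2, mem_iUnion.2 ⟨r, hcr, B, iB, oB⟩⟩
  rintro _ ⟨t, ht, rfl⟩
  rw [Metric.mem_closure_iff]
  intro ε hε
  obtain ⟨c, hc1, hc2, hcQ⟩ := key (max a (t - ε)) (min b (t + ε)) (le_max_left _ _)
    (by rw [max_lt_iff, lt_min_iff, lt_min_iff]
        refine ⟨⟨hab', ?_⟩, ?_, ?_⟩ <;> linarith [ht.1, ht.2]) (min_le_left _ _)
  rw [max_lt_iff] at hc1
  rw [lt_min_iff] at hc2
  have hc : c ∈ Icc a b := ⟨hc1.1.le, hc2.1.le⟩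
  refine ⟨α c, ⟨hcQ, c, hc, rfl⟩, ?_⟩
  rw [hα t ht c hc, abs_lt]
  constructor <;> linarith

theorem rt_hull {T : Type*} [MetricSpace T] (hT : IsRealTree T) (K : Set T) (hK : IsCompact K) :
    ∃ Y, K ⊆ Y ∧ IsCompact Y ∧ IsSubtree Y := by
  haveI := hT.2.1
  obtain ⟨o⟩ := hT.1
  choose S h1 h2 h3 h4 h5 _ h7 using rt_seg hT
  have htri : ∀ k f, S o k ⊆ S o f ∪ S f k := by
    intro k f c hc
    by_contra hcon
    rw [mem_union, not_or] at hcon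
    have hco : c ≠ o := by rintro rfl; exact hcon.1 (h1 _ _)
    have hck : c ≠ k := by rintro rfl; exact hcon.2 (h2 _ _)
    apply h7 o k c hc hco hck
    have hU : IsPreconnected (S o f ∪ S f k) := (h4 o f).union f (h2 _ _) (h1 _ _) (h4 f k)
    apply connectedComponentIn_eq
    refine hU.subset_connectedComponentIn (Or.inl (h1 _ _)) ?_ (Or.inr (h2 _ _))
    rintro w hw rfl
    exact hw.elim hcon.1 hcon.2
  set Z : Set T := {o} ∪ ⋃ k ∈ K, S o k with hZ
  have hZtb : TotallyBounded Z := by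
    rw [Metric.totallyBounded_iff]
    intro ε hε
    obtain ⟨F, hF, hFK⟩ := Metric.totallyBounded_iff.1 hK.totallyBounded (ε / 2) (by linarith)
    have hW : IsCompact ({o} ∪ ⋃ f ∈ F, S o f) :=
      isCompact_singleton.union (hF.isCompact_biUnion fun f _ => h3 o f)
    obtain ⟨G, hG, hGW⟩ := Metric.totallyBounded_iff.1 hW.totallyBounded (ε / 2) (by linarith)
    refine ⟨G, hG, ?_⟩
    have near : ∀ z ∈ Z, ∃ w ∈ ({o} ∪ ⋃ f ∈ F, S o f), dist z w < ε / 2 := by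
      intro z hz
      rcases hz with hz | hz
      · exact ⟨z, Or.inl hz, by rw [dist_self]; linarith⟩
      · simp only [mem_iUnion] at hz
        obtain ⟨k, hk, hz⟩ := hz
        have := hFK hk
        simp only [mem_iUnion] at this
        obtain ⟨f, hf, hkf⟩ := this
        rcases htri k f hz with hz | hz
        · exact ⟨z, Or.inr (mem_biUnion hf hz), by rw [dist_self]; linarith⟩
        · refine ⟨f, Or.inr (mem_biUnion hf (h2 _ _)), ?_⟩
          have := h5 f k z hz
          rw [mem_ball, dist_comm] at hkf
          rw [dist_comm]
          linarith [dist_nonneg (x := z) (y := k)]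
    intro z hz
    obtain ⟨w, hw, hzw⟩ := near z hz
    have := hGW hw
    simp only [mem_iUnion] at this ⊢
    obtain ⟨g, hg, hwg⟩ := this
    rw [mem_ball] at hwg
    refine ⟨g, hg, ?_⟩
    rw [mem_ball]
    linarith [dist_triangle z w g]
  refine ⟨closure Z, ?_, hZtb.closure.isCompact_of_isClosed isClosed_closure, ?_, isClosed_closure, ?_⟩
  · intro k hk
    exact subset_closure (Or.inr (mem_biUnion hk (h2 _ _)))
  · exact ⟨o, subset_closure (Or.inl rfl)⟩
  · apply IsPreconnected.closure
    refine isPreconnected_of_forall o ?_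
    intro z hz
    rcases hz with hz | hz
    · exact ⟨{o}, subset_union_left, rfl, hz, isPreconnected_singleton⟩
    · simp only [mem_iUnion] at hz
      obtain ⟨k, hk, hz⟩ := hz
      refine ⟨S o k, ?_, h1 _ _, hz, h4 _ _⟩
      intro w hw
      exact Or.inr (mem_biUnion hk hw)

/-- The underlying tree of a long dendron is separable, has a countable subset dense
in every proper segment, and for every `ε > 0` there are a compact subtree `Y` and
`a > 0` with `ν(Y×[0,a]) > 1 - ε`. -/
theorem statement16 (D : LongDendron) :
    TopologicalSpace.SeparableSpace D.carrier ∧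
    (∃ Q : Set D.carrier, Q.Countable ∧
      ∀ x y : D.carrier, x ≠ y → ∀ S : Set D.carrier, IsSegment x y S →
        S ⊆ closure (Q ∩ S)) ∧
    ∀ ε : ℝ, 0 < ε → ∃ (Y : Set D.carrier) (a : ℝ≥0),
      IsCompact Y ∧ IsSubtree Y ∧ 0 < a ∧
      1 - ε < (D.ν (Y ×ˢ Set.Iic a)).toReal := by
  have hT := D.isRealTree
  haveI := D.isProb
  haveI := hT.2.1
  obtain ⟨o⟩ := hT.1
  have hQ := rtQ_countable D o
  have hsep : TopologicalSpace.SeparableSpace D.carrier := by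
    by_cases hs : Subsingleton D.carrier
    · infer_instance
    · rw [not_subsingleton_iff_nontrivial] at hs
      refine ⟨rtQ o, hQ, ?_⟩
      intro x
      obtain ⟨y, hy⟩ := exists_ne x
      obtain ⟨a, b, hab, α, hα, ha, hb, hs⟩ := hT.2.2 x y hy.symm
      have := rtQ_dense hT o x y hy.symm (α '' Icc a b)
        ⟨a, b, hab.le, α, hα, ha, hb, rfl, hs⟩ ⟨a, ⟨le_rfl, hab.le⟩, ha⟩
      exact closure_mono inter_subset_left this
  refine ⟨hsep, ⟨rtQ o, hQ, fun x y hxy S hS => rtQ_dense hT o x y hxy S hS⟩, ?_⟩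
  intro ε hε
  haveI : SecondCountableTopology D.carrier := UniformSpace.secondCountable_of_separable _
  obtain ⟨K, -, hK, hKν⟩ := (MeasurableSet.univ (α := D.carrier × ℝ≥0)).exists_isCompact_lt_add
    (μ := D.ν) (measure_ne_top _ _) (ε := ENNReal.ofReal ε) (by simpa using hε)
  obtain ⟨Y, hKY, hYc, hYs⟩ := rt_hull hT (Prod.fst '' K) (hK.image continuous_fst)
  obtain ⟨a, ha⟩ := (hK.image continuous_snd).bddAbove
  refine ⟨Y, a + 1, hYc, hYs, by positivity, ?_⟩
  have hsub : K ⊆ Y ×ˢ Iic (a + 1) := by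
    intro z hz
    exact ⟨hKY ⟨z, hz, rfl⟩, (ha ⟨z, hz, rfl⟩).trans (by simp)⟩
  have h1 : D.ν univ < D.ν (Y ×ˢ Iic (a + 1)) + ENNReal.ofReal ε :=
    hKν.trans_le (by gcongr)
  rw [measure_univ] at h1
  have h2 := (ENNReal.toReal_lt_toReal (by simp) (by finiteness)).2 h1
  rw [ENNReal.toReal_add (by finiteness) (by finiteness), ENNReal.toReal_ofReal hε.le] at h2
  simp at h2
  linarith


end
end

section
/- Let n ≥ 1 and let A be an n×n real matrix. If (T,d,μ) and (T',d',μ') are both A-trees, then there exists a bijective isometry f from (T,d) onto (T',d') that pushes the measure μ forward to μ'; that is, the A-tree is unique up to measure-preserving isometry. -/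
open scoped NNReal ENNReal

open MeasureTheory Metric Filter Topology Set
open scoped NNReal ENNReal

noncomputable section

theorem rt_geod {T : Type*} [MetricSpace T] (hT : IsRealTree T) (p q : T) :
    ∃ S : Set T, IsPreconnected S ∧ p ∈ S ∧ q ∈ S ∧
      (∀ x ∈ S, dist p x + dist x q = dist p q) ∧
      ∀ s : ℝ, 0 ≤ s → s ≤ dist p q → ∃ x ∈ S, dist p x = s ∧
        (0 < s → s < dist p q →
          connectedComponentIn ({x}ᶜ) p ≠ connectedComponentIn ({x}ᶜ) q) := by
  by_cases hpq : p = q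
  · subst hpq
    refine ⟨{p}, isPreconnected_singleton, rfl, rfl, by simp, ?_⟩
    intro s h0 h1
    refine ⟨p, rfl, ?_, ?_⟩
    · simp at h1 ⊢; linarith
    · intro h2 h3; simp at h3; linarith
  · obtain ⟨a, b, hab, α, hα, rfl, rfl, hsep⟩ := hT.2.2 p q hpq
    have ha : a ∈ Icc a b := ⟨le_rfl, hab.le⟩
    have hb : b ∈ Icc a b := ⟨hab.le, le_rfl⟩
    have hd : dist (α a) (α b) = b - a := by
      rw [hα a ha b hb, abs_sub_comm, abs_of_pos (by linarith)]
    have hcont : ContinuousOn α (Icc a b) := by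
      have : LipschitzOnWith 1 α (Icc a b) := by
        apply LipschitzOnWith.of_dist_le_mul
        intro x hx y hy
        rw [hα x hx y hy, Real.dist_eq]; simp
      exact this.continuousOn
    refine ⟨α '' Icc a b, isPreconnected_Icc.image _ hcont, ⟨a, ha, rfl⟩, ⟨b, hb, rfl⟩, ?_, ?_⟩
    · rintro _ ⟨c, hc, rfl⟩
      rw [hd, hα a ha c hc, hα c hc b hb, abs_sub_comm, abs_of_nonneg (by linarith [hc.1]),
        abs_sub_comm, abs_of_nonneg (by linarith [hc.2])]
      ring
    · intro s h0 h1
      rw [hd] at h1 ⊢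
      have hc : a + s ∈ Icc a b := ⟨by linarith, by linarith⟩
      refine ⟨α (a + s), ⟨_, hc, rfl⟩, ?_, ?_⟩
      · rw [hα a ha _ hc, abs_sub_comm, abs_of_nonneg (by linarith)]; ring
      · intro h2 h3
        exact hsep _ (by linarith) (by linarith)

theorem rt_sep {T : Type*} [MetricSpace T] (hT : IsRealTree T) (p y z : T)
    (h : dist p y ≠ dist p z + dist z y) :
    connectedComponentIn ({z}ᶜ) p = connectedComponentIn ({z}ᶜ) y := by
  obtain ⟨S, hS, hp, hy, hd, -⟩ := rt_geod hT p y
  have hz : S ⊆ {z}ᶜ := by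
    intro w hw hwz
    have hwz' : w = z := hwz
    subst hwz'
    exact h (hd w hw).symm
  exact connectedComponentIn_eq (hS.subset_connectedComponentIn hp hz hy)

theorem rt_alt {T : Type*} [MetricSpace T] (hT : IsRealTree T) (p q x y : T)
    (h : dist p x + dist x q = dist p q) :
    dist p y = dist p x + dist x y ∨ dist q y = dist q x + dist x y := by
  by_cases hp : x = p
  · subst hp; left; simp
  by_cases hq : x = q
  · subst hq; right; simp
  have h1 : 0 < dist p x := dist_pos.2 (Ne.symm hp)
  have h2 : 0 < dist x q := dist_pos.2 hq
  obtain ⟨S, -, -, -, hS, hS'⟩ := rt_geod hT p q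
  obtain ⟨z, hz, hpz, hsep⟩ := hS' (dist p x) h1.le (by linarith)
  have hsep := hsep h1 (by linarith)
  have hzq := hS z hz
  have key : ∀ y, dist p y = dist p z + dist z y ∨ dist q y = dist q z + dist z y := by
    intro y
    by_contra hcon
    push Not at hcon
    exact hsep ((rt_sep hT p y z hcon.1).trans (rt_sep hT q y z hcon.2).symm)
  have hzx : z = x := by
    apply dist_le_zero.1
    rcases key x with h' | h'
    · linarith
    · rw [dist_comm q x, dist_comm q z] at h'; linarith
  subst hzx
  exact key y

theorem rt_dist {T : Type*} [MetricSpace T] (hT : IsRealTree T) (o u v x y : T)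
    (hx : dist o x + dist x u = dist o u) (hy : dist o y + dist y v = dist o v) :
    dist x y = max |dist o x - dist o y|
      (dist o x + dist o y - dist o u - dist o v + dist u v) := by
  -- case of the first point on the second segment
  have case1 : ∀ (u v x y : T), dist o x + dist x u = dist o u → dist o y + dist y v = dist o v →
      dist o x + dist x v = dist o v → dist x y = max |dist o x - dist o y|
      (dist o x + dist o y - dist o u - dist o v + dist u v) := by
    intro u v x y hx hy hxv
    have t1 := dist_triangle u x v
    have t2 := dist_triangle o x y
    have t3 := dist_triangle o y x
    have e : dist x y = |dist o x - dist o y| := by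
      apply le_antisymm
      · rcases rt_alt hT o v x y hxv with h | h
        · rw [abs_sub_comm]; exact le_trans (by linarith) (le_abs_self _)
        · rw [dist_comm v y, dist_comm v x] at h
          exact le_trans (by linarith) (le_abs_self _)
      · rw [dist_comm y x] at t3
        exact abs_le.2 ⟨by linarith, by linarith⟩
    rw [max_eq_left, e]
    rw [abs_sub_comm]
    rw [dist_comm u x] at t1
    exact le_trans (by linarith) (le_abs_self _)
  have case2 : dist o y + dist y u = dist o u → dist x y = max |dist o x - dist o y|
      (dist o x + dist o y - dist o u - dist o v + dist u v) := by
    intro h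
    rw [dist_comm x y, case1 v u y x hy hx h, abs_sub_comm, dist_comm v u]
    congr 1; ring
  rcases rt_alt hT o u x v hx with h | h
  · exact case1 u v x y hx hy h.symm
  rcases rt_alt hT o v y x hy with h' | h'
  · apply case2
    have t1 := dist_triangle y x u
    have t2 := dist_triangle o y u
    linarith
  · rw [dist_comm v x, dist_comm v y, dist_comm y x] at h'
    rw [dist_comm u x] at h
    have t2 := dist_triangle o x y
    have t3 := dist_triangle o y x
    rw [dist_comm y x] at t3
    rw [max_eq_right]
    · linarith
    · exact abs_le.2 ⟨by linarith, by linarith⟩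

theorem rt_cover {T : Type*} [MetricSpace T] (hT : IsRealTree T) {n : ℕ} (q : Fin n → T)
    (i0 : Fin n) (hq : ∀ Y : Set T, IsSubtree Y → (∀ i, q i ∈ Y) → Y = Set.univ) (x : T) :
    ∃ i, dist (q i0) x + dist x (q i) = dist (q i0) (q i) := by
  have := hq (⋃ i, {x | dist (q i0) x + dist x (q i) = dist (q i0) (q i)}) ?_ ?_
  · have hx : x ∈ (Set.univ : Set T) := trivial
    rw [← this] at hx
    simpa using hx
  · refine ⟨⟨q i0, ?_⟩, ?_, ?_⟩
    · exact mem_iUnion.2 ⟨i0, by simp⟩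
    · apply isClosed_iUnion_of_finite
      intro i
      exact isClosed_eq (by fun_prop) (by fun_prop)
    · apply isPreconnected_iUnion
      · exact ⟨q i0, by simp⟩
      · intro i
        obtain ⟨S, h1, h2, h3, h4, h5⟩ := rt_geod hT (q i0) (q i)
        convert h1 using 1
        ext x
        refine ⟨fun hx => ?_, h4 x⟩
        have hx : dist (q i0) x + dist x (q i) = dist (q i0) (q i) := hx
        obtain ⟨z, hz, hz', -⟩ := h5 (dist (q i0) x) dist_nonneg
          (by linarith [dist_nonneg (x := x) (y := q i)])
        have e := rt_dist hT (q i0) (q i) (q i) x z hx (h4 z hz)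
        rw [hz', dist_self, sub_self, abs_zero, max_eq_left] at e
        · rw [dist_eq_zero.1 e]; exact hz
        · linarith [dist_nonneg (x := x) (y := q i)]
  · intro i
    exact mem_iUnion.2 ⟨i, by simp⟩

/-- An `A`-tree is unique up to measure-preserving isometry. -/
theorem statement18 {T T' : Type}
    [MetricSpace T] [MeasurableSpace T] [BorelSpace T]
    [MetricSpace T'] [MeasurableSpace T'] [BorelSpace T']
    [TopologicalSpace.SeparableSpace T] [TopologicalSpace.SeparableSpace T']
    (hT : IsRealTree T) (hT' : IsRealTree T')
    (μ : Measure T) (μ' : Measure T')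
    [IsProbabilityMeasure μ] [IsProbabilityMeasure μ']
    (n : ℕ) (hn : 1 ≤ n) (A : Fin n → Fin n → ℝ)
    (hA : IsATree n A μ) (hA' : IsATree n A μ') :
    ∃ f : T → T', Isometry f ∧ Function.Bijective f ∧ Measure.map f μ = μ' := by
  obtain ⟨q, hq, hq2, hq3⟩ := hA
  obtain ⟨q', hq', hq2', hq3'⟩ := hA'
  have hd : ∀ i j, dist (q i) (q j) = dist (q' i) (q' j) := by
    intro i j
    by_cases hij : i = j
    · subst hij; simp
    · have h1 := hq i j
      have h2 := hq' i j
      rw [if_neg hij] at h1 h2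
      rw [h1, h2]
  let o : Fin n := ⟨0, hn⟩
  choose I hI using rt_cover hT q o hq2
  have hex : ∀ x, ∃ x', dist (q' o) x' = dist (q o) x ∧
      dist (q' o) x' + dist x' (q' (I x)) = dist (q' o) (q' (I x)) := by
    intro x
    obtain ⟨S, -, -, -, h4, h5⟩ := rt_geod hT' (q' o) (q' (I x))
    obtain ⟨z, hz, hz', -⟩ := h5 (dist (q o) x) dist_nonneg
      (by rw [← hd, ← hI x]; linarith [dist_nonneg (x := x) (y := q (I x))])
    exact ⟨z, hz', h4 z hz⟩
  choose f hf hf' using hex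
  -- comparison of distances
  have key : ∀ x j y', ∀ y, dist (q o) y + dist y (q j) = dist (q o) (q j) →
      dist (q' o) y' + dist y' (q' j) = dist (q' o) (q' j) → dist (q' o) y' = dist (q o) y →
      dist (f x) y' = dist x y := by
    intro x j y' y h1 h2 h3
    rw [rt_dist hT (q o) (q (I x)) (q j) x y (hI x) h1,
      rt_dist hT' (q' o) (q' (I x)) (q' j) (f x) y' (hf' x) h2, hf, h3, hd, hd, hd]
  have hiso : Isometry f := Isometry.of_dist_eq fun x y =>
    key x (I y) (f y) y (hI y) (hf' y) (hf y)
  have hfix : ∀ i, f (q i) = q' i := by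
    intro i
    have := key (q i) i (q' i) (q i) (by simp) (by simp) (hd o i).symm
    rw [dist_self] at this
    exact dist_eq_zero.1 this
  refine ⟨f, hiso, ⟨hiso.injective, ?_⟩, ?_⟩
  · intro y'
    obtain ⟨j, hj⟩ := rt_cover hT' q' o hq2' y'
    obtain ⟨S, -, -, -, h4, h5⟩ := rt_geod hT (q o) (q j)
    obtain ⟨z, hz, hz', -⟩ := h5 (dist (q' o) y') dist_nonneg
      (by rw [hd, ← hj]; linarith [dist_nonneg (x := y') (y := q' j)])
    refine ⟨z, ?_⟩
    have := key z j y' z (h4 z hz) hj hz'.symm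
    rw [dist_self] at this
    exact dist_eq_zero.1 this
  · ext H hH
    rw [Measure.map_apply hiso.continuous.measurable hH,
      hq3 _ (hiso.continuous.measurable hH), hq3' _ hH]
    simp only [mem_preimage, hfix]

end
end

section
/- Let (T,d,μ) be a finite real tree of diameter at most 1. Then there exists a sequence (T_n) of nontrivial finite trees such that for every integer r ≥ 1 the sampling measures τ_r(T_n) converge weakly to τ_r(T,d,μ) in the space of Borel probability measures on M_r. -/
open scoped NNReal ENNReal

open MeasureTheory Metric Filter Topology Set
open scoped NNReal ENNReal
noncomputable section
theorem aux_tree {V : Type} [Fintype V] [Nonempty V] (f : V → V → ℕ) (lv : V → ℕ)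
    (h0 : ∀ u v, f u v = 0 ↔ u = v) (hs : ∀ u v, f u v = f v u)
    (ht : ∀ u v w, f u w ≤ f u v + f v w)
    (hstep : ∀ u v k, f u v = k + 1 → ∃ z, f u z = 1 ∧ f z v = k)
    (hlv : ∀ u v, f u v = 1 → lv u ≠ lv v)
    (huniq : ∀ u v w, f u v = 1 → f u w = 1 → lv v < lv u → lv w < lv u → v = w) :
    ∃ G : SimpleGraph V, G.IsTree ∧ ∀ u v, G.dist u v = f u v := by
  classical
  let G : SimpleGraph V :=
    { Adj := fun u v => f u v = 1
      symm := ⟨fun u v h => by rw [hs]; exact h⟩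
      loopless := ⟨fun u h => by have := (h0 u u).2 rfl; omega⟩ }
  have hadj : ∀ u v, G.Adj u v ↔ f u v = 1 := fun u v => Iff.rfl
  have hwalk : ∀ k u v, f u v = k → ∃ p : G.Walk u v, p.length = k := by
    intro k
    induction k with
    | zero =>
      intro u v h
      obtain rfl := (h0 u v).1 h
      exact ⟨SimpleGraph.Walk.nil, rfl⟩
    | succ k ih =>
      intro u v h
      obtain ⟨z, h1, h2⟩ := hstep u v k h
      obtain ⟨p, hp⟩ := ih z v h2
      exact ⟨SimpleGraph.Walk.cons ((hadj _ _).2 h1) p, by simp [hp]⟩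
  have hle : ∀ u v (p : G.Walk u v), f u v ≤ p.length := by
    intro u v p
    induction p with
    | nil => simp [(h0 _ _).2 rfl]
    | @cons a b c h p ih =>
      have h1 : f a b = 1 := h
      have := ht a b c
      simp only [SimpleGraph.Walk.length_cons]
      omega
  have hconn : G.Connected :=
    { preconnected := fun u v => (hwalk _ u v rfl).elim fun p _ => ⟨p⟩
      nonempty := inferInstance }
  refine ⟨G, ?_, ?_⟩
  · rw [SimpleGraph.isTree_iff_connected_and_card]
    refine ⟨hconn, le_antisymm ?_ hconn.card_vert_le_card_edgeSet_add_one⟩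
    obtain ⟨r, hr⟩ := Finite.exists_min lv
    let p : V → V := fun v => if h : ∃ w, f v w = 1 ∧ lv w < lv v then h.choose else v
    have hp : ∀ v w, f v w = 1 → lv w < lv v → p v = w := by
      intro v w h1 h2
      have h : ∃ w, f v w = 1 ∧ lv w < lv v := ⟨w, h1, h2⟩
      have : p v = h.choose := by simp only [p]; rw [dif_pos h]
      rw [this]
      exact huniq v _ _ h.choose_spec.1 h1 h.choose_spec.2 h2
    have hsub : G.edgeFinset ⊆ (Finset.univ.erase r).image fun v => s(v, p v) := by
      intro e he
      rw [SimpleGraph.mem_edgeFinset] at he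
      induction e using Sym2.ind with
      | _ u v =>
        have h1 : f u v = 1 := he
        rcases lt_or_gt_of_ne (hlv u v h1) with h | h
        · refine Finset.mem_image.2 ⟨v, ?_, ?_⟩
          · refine Finset.mem_erase.2 ⟨?_, Finset.mem_univ _⟩
            rintro rfl
            exact absurd (hr u) (by omega)
          · rw [hp v u (by rw [hs]; exact h1) h]; exact Sym2.eq_swap
        · refine Finset.mem_image.2 ⟨u, ?_, ?_⟩
          · refine Finset.mem_erase.2 ⟨?_, Finset.mem_univ _⟩
            rintro rfl
            exact absurd (hr v) (by omega)
          · rw [hp u v h1 h]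
    have h1 := (Finset.card_le_card hsub).trans Finset.card_image_le
    rw [Finset.card_erase_of_mem (Finset.mem_univ _), Finset.card_univ] at h1
    have h2 : Nat.card G.edgeSet = G.edgeFinset.card := by
      rw [Nat.card_eq_fintype_card, SimpleGraph.edgeFinset_card]
    rw [h2, Nat.card_eq_fintype_card]
    have : 0 < Fintype.card V := Fintype.card_pos
    omega
  · intro u v
    apply le_antisymm
    · obtain ⟨p, hp⟩ := hwalk _ u v rfl
      rw [← hp]; exact SimpleGraph.dist_le p
    · obtain ⟨p, hp⟩ := hconn.exists_walk_length_eq_dist u v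
      rw [← hp]; exact hle u v p

/-- pseudo-distance -/
def auxF {I : Type} (P : I → I → ℕ) (x y : Σ i : I, Fin (P i i + 1)) : ℕ :=
  x.2.1 + y.2.1 - 2 * min x.2.1 (min y.2.1 (P x.1 y.1))

theorem aux_tree2 {I : Type} [Fintype I] [Nonempty I] (P : I → I → ℕ)
    (hsymm : ∀ i j, P i j = P j i) (hle : ∀ i j, P i j ≤ P i i)
    (hult : ∀ i j k, min (P i j) (P j k) ≤ P i k) :
    ∃ (V : Set (Σ i : I, Fin (P i i + 1))) (G : SimpleGraph V), G.IsTree ∧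
      (∀ u v : V, G.dist u v = auxF P u v) ∧
      (∀ x, ∃ v ∈ V, auxF P x v = 0) ∧
      (∀ u ∈ V, ∀ v ∈ V, auxF P u v = 0 → u = v) := by
  classical
  have hxx : ∀ x, auxF P x x = 0 := by
    rintro ⟨i, a, ha⟩
    simp only [auxF]; omega
  have hs : ∀ x y, auxF P x y = auxF P y x := by
    rintro ⟨i, a, ha⟩ ⟨j, b, hb⟩
    have := hsymm i j
    simp only [auxF]; omega
  have ht : ∀ x y z, auxF P x z ≤ auxF P x y + auxF P y z := by
    rintro ⟨i, a, ha⟩ ⟨j, b, hb⟩ ⟨k, c, hc⟩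
    have := hult i j k
    simp only [auxF]; omega
  have hstep : ∀ x y k, auxF P x y = k + 1 → ∃ z, auxF P x z = 1 ∧ auxF P z y = k := by
    rintro ⟨i, a, ha⟩ ⟨j, b, hb⟩ k h
    simp only [auxF] at h
    by_cases hc : a ≤ min b (P i j)
    · refine ⟨⟨j, a + 1, by omega⟩, ?_, ?_⟩
      · simp only [auxF]; omega
      · simp only [auxF]; omega
    · refine ⟨⟨i, a - 1, by omega⟩, ?_, ?_⟩
      · simp only [auxF]; omega
      · simp only [auxF]; omega
  let S : Setoid (Σ i : I, Fin (P i i + 1)) :=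
    { r := fun x y => auxF P x y = 0
      iseqv := ⟨hxx, fun {x y} h => by rw [hs]; exact h,
        fun {x y z} h1 h2 => by have := ht x y z; omega⟩ }
  let rep : (Σ i : I, Fin (P i i + 1)) → (Σ i : I, Fin (P i i + 1)) :=
    fun x => (Quotient.mk S x).out
  have hrep : ∀ x, auxF P x (rep x) = 0 := by
    intro x
    rw [hs]
    exact Quotient.mk_out (s := S) x
  have hrepeq : ∀ x y, auxF P x y = 0 → rep x = rep y := by
    intro x y h
    have : Quotient.mk S x = Quotient.mk S y := Quotient.sound h
    simp only [rep, this]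
  have hrr : ∀ x, rep (rep x) = rep x := fun x => (hrepeq _ _ (hrep x)).symm
  let V : Set (Σ i : I, Fin (P i i + 1)) := Set.range rep
  have hV : ∀ v ∈ V, rep v = v := by rintro _ ⟨x, rfl⟩; exact hrr x
  have hsep : ∀ u ∈ V, ∀ v ∈ V, auxF P u v = 0 → u = v := by
    intro u hu v hv h
    rw [← hV u hu, ← hV v hv, hrepeq u v h]
  have : Nonempty V := by
    obtain ⟨i⟩ := ‹Nonempty I›
    exact ⟨⟨rep ⟨i, 0⟩, _, rfl⟩⟩
  obtain ⟨G, hG, hd⟩ := aux_tree (V := V) (fun u v => auxF P u v) (fun u => u.1.2.1)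
    (fun u v => ⟨fun h => Subtype.ext (hsep _ u.2 _ v.2 h), fun h => by rw [h]; exact hxx _⟩)
    (fun u v => hs _ _) (fun u v w => ht _ _ _)
    (by
      intro u v k h
      obtain ⟨z, h1, h2⟩ := hstep u v k h
      have h3 := hrep z
      have h3' := hrep z
      rw [hs] at h3'
      refine ⟨⟨rep z, _, rfl⟩, ?_, ?_⟩
      · have := ht u z (rep z)
        have := ht u (rep z) z
        simp only; omega
      · have := ht (rep z) z v
        have := ht z (rep z) v
        simp only; omega)
    (by
      rintro ⟨⟨i, a, ha⟩, h1⟩ ⟨⟨j, b, hb⟩, h2⟩ h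
      simp only [auxF] at h ⊢
      omega)
    (by
      rintro ⟨⟨i, a, ha⟩, h1⟩ ⟨⟨j, b, hb⟩, h2⟩ ⟨⟨k, c, hc⟩, h3⟩ h4 h5 h6 h7
      apply Subtype.ext
      apply hsep _ h2 _ h3
      have := hult j i k
      have := hsymm j i
      simp only [auxF] at h4 h5 h6 h7 ⊢
      omega)
  exact ⟨V, G, hG, hd, fun x => ⟨rep x, ⟨x, rfl⟩, hrep x⟩, hsep⟩

def auxP {S : Type} (k : S → ℕ) (Q : S → S → ℕ) (L : ℕ) :
    ((Σ s : S, Fin (k s)) ⊕ Unit) → ((Σ s : S, Fin (k s)) ⊕ Unit) → ℕ := by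
  classical
  exact fun i j => match i, j with
  | .inl x, .inl y => if x = y then Q x.1 x.1 + 1 else Q x.1 y.1
  | .inl _, .inr _ => 0
  | .inr _, .inl _ => 0
  | .inr _, .inr _ => L

theorem auxP_ll {S : Type} (k : S → ℕ) (Q : S → S → ℕ) (L : ℕ) (x y : Σ s : S, Fin (k s))
    (h : x ≠ y) : auxP k Q L (.inl x) (.inl y) = Q x.1 y.1 := by
  simp [auxP, h]

theorem auxP_self {S : Type} (k : S → ℕ) (Q : S → S → ℕ) (L : ℕ) (x : Σ s : S, Fin (k s)) :
    auxP k Q L (.inl x) (.inl x) = Q x.1 x.1 + 1 := by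
  simp [auxP]

theorem auxP_lr {S : Type} (k : S → ℕ) (Q : S → S → ℕ) (L : ℕ) (x : Σ s : S, Fin (k s)) (y : Unit) :
    auxP k Q L (.inl x) (.inr y) = 0 := rfl
theorem auxP_rl {S : Type} (k : S → ℕ) (Q : S → S → ℕ) (L : ℕ) (x : Σ s : S, Fin (k s)) (y : Unit) :
    auxP k Q L (.inr y) (.inl x) = 0 := rfl
theorem auxP_rr {S : Type} (k : S → ℕ) (Q : S → S → ℕ) (L : ℕ) (x y : Unit) :
    auxP k Q L (.inr y) (.inr x) = L := rfl

theorem aux_tree3 {S : Type} [Fintype S] (n : ℕ) (k : S → ℕ) (hk : ∀ s, 0 < k s)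
    (Q : S → S → ℕ)
    (hsymm : ∀ i j, Q i j = Q j i) (hle : ∀ i j, Q i j ≤ Q i i)
    (hult : ∀ i j k, min (Q i j) (Q j k) ≤ Q i k)
    (hn : ∀ s, Q s s ≤ n) (hd : ∀ s t, Q s s + Q t t ≤ 2 * Q s t + n + 2)
    (s₀ : S) (hs₀ : ∀ s, Q s s ≤ Q s₀ s₀) :
    ∃ (V : Type) (_ : Fintype V) (G : SimpleGraph V) (lab : V → Option S), G.IsTree ∧
      (∀ s, Nat.card {v // lab v = some s} = k s) ∧
      (Nat.card {v // lab v = none} ≤ (Fintype.card S + 1) * (n + 2)) ∧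
      n + 1 ≤ graphDiam G ∧ graphDiam G ≤ n + 4 ∧
      (∀ u v s t, lab u = some s → lab v = some t → u ≠ v →
        G.dist u v + 2 * Q s t = Q s s + Q t t + 2) := by
  classical
  set L := n - Q s₀ s₀ with hL
  have hL' := hn s₀
  set P := auxP k Q L with hP
  have hPs : ∀ i j, P i j = P j i := by
    rintro (x | x) (y | y)
    · by_cases h : x = y
      · rw [h]
      · rw [hP, auxP_ll _ _ _ _ _ h, auxP_ll _ _ _ _ _ (Ne.symm h), hsymm]
    · rfl
    · rfl
    · rfl
  have hPle : ∀ i j, P i j ≤ P i i := by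
    rintro (x | x) (y | y)
    · by_cases h : x = y
      · rw [h]
      · rw [hP, auxP_ll _ _ _ _ _ h, auxP_self]
        have := hle x.1 y.1
        omega
    · exact Nat.zero_le _
    · exact Nat.zero_le _
    · exact le_rfl
  have hPu : ∀ i j k, min (P i j) (P j k) ≤ P i k := by
    intro i j l
    by_cases hij : i = j
    · subst hij; exact min_le_right _ _
    by_cases hjl : j = l
    · subst hjl; exact min_le_left _ _
    by_cases hil : i = l
    · subst hil; exact (min_le_left _ _).trans (hPle _ _)
    rcases i with (x | x) <;> rcases j with (y | y) <;> rcases l with (z | z)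
    · have h1 : x ≠ y := fun h => hij (by rw [h])
      have h2 : y ≠ z := fun h => hjl (by rw [h])
      have h3 : x ≠ z := fun h => hil (by rw [h])
      rw [hP, auxP_ll _ _ _ _ _ h1, auxP_ll _ _ _ _ _ h2, auxP_ll _ _ _ _ _ h3]
      exact hult _ _ _
    all_goals simp [hP, auxP_lr, auxP_rl, auxP_rr]
  obtain ⟨V, G, hG, hdist, hrep, hsep⟩ := aux_tree2 P hPs hPle hPu
  -- leaves
  let leaf : (Σ s : S, Fin (k s)) → (Σ i, Fin (P i i + 1)) := fun x => ⟨.inl x, Fin.last _⟩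
  have hleaf : ∀ x y, auxF P (leaf x) y = 0 → y = leaf x := by
    rintro x ⟨(y | y), b, hb⟩ h
    · by_cases hxy : x = y
      · subst hxy
        simp only [auxF, leaf, Fin.val_last] at h
        simp only [leaf]
        congr 1
        apply Fin.ext
        simp only [Fin.val_last]
        omega
      · exfalso
        have e1 := auxP_ll k Q L x y hxy
        have e2 := auxP_self k Q L x
        have e3 := auxP_self k Q L y
        have := hle x.1 y.1
        rw [← hP] at e1 e2 e3
        simp only [auxF, leaf, Fin.val_last] at h
        omega
    · exfalso
      have e1 := auxP_lr k Q L x y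
      have e2 := auxP_self k Q L x
      rw [← hP] at e1 e2
      simp only [auxF, leaf, Fin.val_last] at h
      omega
  have hleafV : ∀ x, leaf x ∈ V := by
    intro x
    obtain ⟨v, hv, h⟩ := hrep (leaf x)
    rw [← hleaf x v h]; exact hv
  let lab0 : (Σ i, Fin (P i i + 1)) → Option S := fun x => match x with
    | ⟨.inl y, b⟩ => if b.1 = P (.inl y) (.inl y) then some y.1 else none
    | ⟨.inr _, _⟩ => none
  have hlab : ∀ x s, lab0 x = some s → ∃ y, y.1 = s ∧ x = leaf y := by
    rintro ⟨(y | y), b⟩ s h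
    · simp only [lab0] at h
      split_ifs at h with h1
      · refine ⟨y, by simpa using h, ?_⟩
        simp only [leaf]
        congr 1
        exact Fin.ext (by simpa using h1)
    · simp [lab0] at h
  have hlab' : ∀ y, lab0 (leaf y) = some y.1 := by
    intro y; simp [lab0, leaf]
  have hupper : ∀ x y, auxF P x y ≤ n + 4 := by
    rintro ⟨i, a, ha⟩ ⟨j, b, hb⟩
    by_cases hij : i = j
    · subst hij
      have : P i i ≤ n + 1 := by
        rcases i with (x | x)
        · rw [hP, auxP_self]; have := hn x.1; omega
        · rw [hP, auxP_rr]; omega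
      simp only [auxF]; omega
    rcases i with (x | x) <;> rcases j with (y | y)
    · have h1 : x ≠ y := fun h => hij (by rw [h])
      have e1 := auxP_ll k Q L x y h1
      have e2 := auxP_self k Q L x
      have e3 := auxP_self k Q L y
      have := hd x.1 y.1
      have := hn x.1
      have := hn y.1
      rw [← hP] at e1 e2 e3
      simp only [auxF]; omega
    · have e2 := auxP_self k Q L x
      have e3 := auxP_rr k Q L y y
      have := hs₀ x.1
      rw [← hP] at e2 e3
      simp only [auxF]; omega
    · have e2 := auxP_self k Q L y
      have e3 := auxP_rr k Q L x x
      have := hs₀ y.1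
      rw [← hP] at e2 e3
      simp only [auxF]; omega
    · exact absurd rfl hij
  have hgd : ∀ u v : V, G.dist u v ≤ graphDiam G := by
    intro u v
    exact Finset.le_sup (f := fun p : V × V => G.dist p.1 p.2) (Finset.mem_univ (u, v))
  refine ⟨V, inferInstance, G, fun v => lab0 v, hG, ?_, ?_, ?_, ?_, ?_⟩
  · intro s
    have e : Fin (k s) ≃ {v : V // lab0 v = some s} := by
      refine Equiv.ofBijective (fun a => ⟨⟨leaf ⟨s, a⟩, hleafV _⟩, hlab' _⟩) ⟨?_, ?_⟩
      · intro a b h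
        have h1 : leaf ⟨s, a⟩ = leaf ⟨s, b⟩ := congrArg (fun z => z.1.1) h
        have h2 : (Sum.inl ⟨s, a⟩ : (Σ s : S, Fin (k s)) ⊕ Unit) = .inl ⟨s, b⟩ := congrArg (fun z => z.1) h1
        simpa using h2
      · rintro ⟨⟨v, hv⟩, h⟩
        obtain ⟨⟨s', a⟩, rfl, rfl⟩ := hlab v s h
        exact ⟨a, rfl⟩
    rw [← Nat.card_congr e]; simp
  · let ψ : {v : V // lab0 v = none} → Option S × Fin (n + 2) := fun v =>
      (match v.1.1.1 with | .inl y => some y.1 | .inr _ => none,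
        ⟨min v.1.1.2.1 (n+1), by omega⟩)
    have hψ : Function.Injective ψ := by
      rintro ⟨⟨⟨i, a, ha⟩, hu⟩, hl⟩ ⟨⟨⟨j, b, hb⟩, hv⟩, hl'⟩ h
      apply Subtype.ext
      apply Subtype.ext
      apply hsep _ hu _ hv
      rcases i with (x | x) <;> rcases j with (y | y)
      · simp only [ψ, Prod.mk.injEq, Option.some.injEq, Fin.mk.injEq] at h
        obtain ⟨h1, h2⟩ := h
        simp only [lab0, ite_eq_right_iff, reduceCtorEq, imp_false] at hl hl'
        have e2 := auxP_self k Q L x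
        have e3 := auxP_self k Q L y
        have := hn x.1
        have := hn y.1
        rw [← hP] at e2 e3
        by_cases hxy : x = y
        · subst hxy
          simp only [auxF]; omega
        · have e1 := auxP_ll k Q L x y hxy
          rw [← hP, ← h1] at e1
          simp only [auxF]; omega
      · simp [ψ] at h
      · simp [ψ] at h
      · simp only [ψ, Prod.mk.injEq, Fin.mk.injEq, true_and] at h
        have e3 := auxP_rr k Q L x x
        rw [← hP] at e3
        have e4 : P (.inr x) (.inr y) = L := auxP_rr k Q L y x
        have e5 : P (.inr y) (.inr y) = L := auxP_rr k Q L y y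
        simp only [auxF]; omega
    have := Nat.card_le_card_of_injective ψ hψ
    simpa [Nat.card_prod] using this
  · have hin : ∃ a : Fin (k s₀), True := ⟨⟨0, hk s₀⟩, trivial⟩
    obtain ⟨a, -⟩ := hin
    obtain ⟨v, hv, h⟩ := hrep ⟨.inr (), Fin.last _⟩
    have h1 := hgd ⟨leaf ⟨s₀, a⟩, hleafV _⟩ ⟨v, hv⟩
    rw [hdist] at h1
    refine le_trans ?_ h1
    obtain ⟨(y | y), b, hb⟩ := v
    · have e3 := auxP_rr k Q L () ()
      have e4 := auxP_rl k Q L y ()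
      have e5 := auxP_self k Q L ⟨s₀, a⟩
      rw [← hP] at e3 e4 e5
      simp only [auxF, leaf, Fin.val_last] at h ⊢
      simp only at e5
      omega
    · have e6 : P (.inr ()) (.inr y) = L := auxP_rr k Q L y ()
      have e3 := auxP_rr k Q L () ()
      have e4 := auxP_lr k Q L ⟨s₀, a⟩ y
      have e5 := auxP_self k Q L ⟨s₀, a⟩
      rw [← hP] at e3 e4 e5
      simp only [auxF, leaf, Fin.val_last] at h ⊢
      simp only at e5
      omega
  · refine Finset.sup_le ?_
    rintro ⟨u, v⟩ -
    simp only [hdist]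
    exact hupper _ _
  · rintro ⟨u, hu⟩ ⟨v, hv⟩ s t h1 h2 huv
    obtain ⟨x, rfl, rfl⟩ := hlab u s h1
    obtain ⟨y, rfl, rfl⟩ := hlab v t h2
    have hxy : x ≠ y := by rintro rfl; exact huv rfl
    rw [hdist]
    have e1 := auxP_ll k Q L x y hxy
    have e2 := auxP_self k Q L x
    have e3 := auxP_self k Q L y
    have := hle x.1 y.1
    have := hle y.1 x.1
    have := hsymm x.1 y.1
    rw [← hP] at e1 e2 e3
    simp only [auxF, leaf, Fin.val_last]
    omega

theorem aux_tree4 {S : Type} [Fintype S] [Nonempty S] (n : ℕ) (hn1 : 1 ≤ n)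
    (k : S → ℕ) (hk : ∀ s, 0 < k s) (P : S → S → ℝ)
    (hsymm : ∀ i j, P i j = P j i) (h0 : ∀ i j, 0 ≤ P i j) (hle : ∀ i j, P i j ≤ P i i)
    (hult : ∀ i j k, min (P i j) (P j k) ≤ P i k)
    (h1 : ∀ s, P s s ≤ 1) (hd : ∀ s t, P s s + P t t - 2 * P s t ≤ 1) :
    ∃ (V : Type) (_ : Fintype V) (G : SimpleGraph V) (lab : V → Option S), G.IsTree ∧
      (∀ s, Nat.card {v // lab v = some s} = k s) ∧
      (Nat.card {v // lab v = none} ≤ (Fintype.card S + 1) * (n + 2)) ∧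
      1 < Fintype.card V ∧
      (∀ u v s t, lab u = some s → lab v = some t →
        |treeDist G u v - (P s s + P t t - 2 * P s t)| ≤ 8 / n) := by
  have hnp : (0:ℝ) < n := by exact_mod_cast hn1
  let Q : S → S → ℕ := fun s t => ⌊(n:ℝ) * P s t⌋₊
  have hmono : ∀ {a b : ℝ}, a ≤ b → ⌊(n:ℝ) * a⌋₊ ≤ ⌊(n:ℝ) * b⌋₊ := fun h =>
    Nat.floor_le_floor (mul_le_mul_of_nonneg_left h hnp.le)
  have hQ1 : ∀ s t, (Q s t : ℝ) ≤ n * P s t := fun s t =>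
    Nat.floor_le (mul_nonneg hnp.le (h0 s t))
  have hQ2 : ∀ s t, (n:ℝ) * P s t < Q s t + 1 := fun s t => Nat.lt_floor_add_one _
  obtain ⟨s₀, hs₀⟩ := Finite.exists_max (fun s => P s s)
  have hdd : ∀ s t, (n:ℝ) * (P s s + P t t - 2 * P s t) ≤ n := fun s t => by
    have := mul_le_mul_of_nonneg_left (hd s t) hnp.le
    linarith
  obtain ⟨V, iV, G, lab, hG, hl1, hl2, hg1, hg2, hdist⟩ := aux_tree3 n k hk Q
    (fun i j => by simp only [Q, hsymm i j]) (fun i j => hmono (hle i j))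
    (fun i j l => by
      have := hult i j l
      rcases min_le_iff.1 this with h | h
      · exact (min_le_left _ _).trans (hmono h)
      · exact (min_le_right _ _).trans (hmono h))
    (fun s => by
      have h2 := hQ1 s s
      have h3 := mul_le_mul_of_nonneg_left (h1 s) hnp.le
      have : (Q s s : ℝ) ≤ n := by linarith
      exact_mod_cast this)
    (fun s t => by
      have := hQ1 s s
      have := hQ1 t t
      have := hQ2 s t
      have := hdd s t
      have : (Q s s + Q t t : ℝ) ≤ 2 * Q s t + n + 2 := by linarith
      exact_mod_cast this)
    s₀ (fun s => hmono (hs₀ s))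
  refine ⟨V, iV, G, lab, hG, hl1, hl2, ?_, ?_⟩
  · by_contra hc
    have : Subsingleton V := Fintype.card_le_one_iff_subsingleton.1 (by omega)
    have : graphDiam G ≤ 0 := by
      refine Finset.sup_le ?_
      rintro ⟨u, v⟩ -
      rw [Subsingleton.elim u v]; simp
    omega
  · intro u v s t hu hv
    have hD1 : (n + 1 : ℝ) ≤ graphDiam G := by exact_mod_cast hg1
    have hD2 : (graphDiam G : ℝ) ≤ n + 4 := by exact_mod_cast hg2
    have hDp : (0:ℝ) < graphDiam G := by linarith
    by_cases huv : u = v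
    · subst huv
      obtain rfl : s = t := by rw [hu] at hv; exact Option.some.inj hv
      simp only [treeDist, SimpleGraph.dist_self]
      rw [show ((0:ℕ):ℝ) / (graphDiam G : ℝ) - (P s s + P s s - 2 * P s s) = 0 by push_cast; ring]
      rw [abs_zero]; positivity
    · have h3 := hdist u v s t hu hv huv
      have h4 : (G.dist u v : ℝ) + 2 * Q s t = Q s s + Q t t + 2 := by exact_mod_cast h3
      have := hQ1 s s
      have := hQ1 t t
      have := hQ1 s t
      have := hQ2 s s
      have := hQ2 t t
      have := hQ2 s t
      set δ := P s s + P t t - 2 * P s t with hδ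
      have hδ1 : δ ≤ 1 := hd s t
      have hδ0 : 0 ≤ δ := by
        have := hle s t
        have := hle t s
        rw [hsymm t s] at this
        linarith
      have e : (n:ℝ) * δ = n * P s s + n * P t t - 2 * (n * P s t) := by rw [hδ]; ring
      have a1 : (G.dist u v : ℝ) ≤ n * δ + 4 := by linarith
      have a2 : n * δ ≤ (G.dist u v : ℝ) := by linarith
      simp only [treeDist]
      rw [abs_le]
      constructor
      · have : δ - 8 / n ≤ (G.dist u v : ℝ) / graphDiam G := by
          rw [le_div_iff₀ hDp]
          have : (8 / (n:ℝ)) * graphDiam G ≥ 8 / n * n := by gcongr; linarith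
          rw [div_mul_cancel₀ _ hnp.ne'] at this
          nlinarith
        linarith
      · have : (G.dist u v : ℝ) / graphDiam G ≤ δ + 8 / n := by
          rw [div_le_iff₀ hDp]
          have : (8 / (n:ℝ)) * graphDiam G ≥ 8 / n * n := by gcongr; linarith
          rw [div_mul_cancel₀ _ hnp.ne'] at this
          nlinarith
        linarith

theorem aux_conv {K : Type} [Fintype K] (r : ℕ) (w : K → ℝ) (V : ℕ → Type)
    [∀ n, Fintype (V n)] (lab : ∀ n, V n → K)
    (hw : ∀ k, Tendsto (fun n => (Nat.card {v // lab n v = k} : ℝ) / Fintype.card (V n)) atTop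
      (𝓝 (w k)))
    (g : ∀ n, (Fin r → V n) → ℝ) (M : ℝ) (hM : ∀ n x, |g n x| ≤ M)
    (γ : (Fin r → K) → ℝ)
    (hg : ∀ σ : Fin r → K, (∀ i, w (σ i) ≠ 0) → ∀ ε > 0, ∀ᶠ n in atTop,
      ∀ x : Fin r → V n, (∀ i, lab n (x i) = σ i) → |g n x - γ σ| ≤ ε) :
    Tendsto (fun n => ∑ x : Fin r → V n, (∏ _i : Fin r, (Fintype.card (V n) : ℝ)⁻¹) * g n x) atTop
      (𝓝 (∑ σ : Fin r → K, (∏ i, w (σ i)) * γ σ)) := by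
  classical
  have e1 : ∀ n, ∑ x : Fin r → V n, (∏ _i : Fin r, (Fintype.card (V n) : ℝ)⁻¹) * g n x
      = ∑ σ : Fin r → K, ∑ x ∈ Finset.univ.filter (fun x : Fin r → V n => (fun i => lab n (x i)) = σ),
        (∏ _i : Fin r, (Fintype.card (V n) : ℝ)⁻¹) * g n x := by
    intro n
    rw [Finset.sum_fiberwise]
  simp_rw [e1]
  refine tendsto_finsetSum _ fun σ _ => ?_
  set c : ℕ → ℝ := fun n => ∏ i, ((Nat.card {v // lab n v = σ i} : ℝ) / Fintype.card (V n)) with hc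
  have hct : Tendsto c atTop (𝓝 (∏ i, w (σ i))) := tendsto_finsetProd _ fun i _ => hw (σ i)
  have hc0 : ∀ n, 0 ≤ c n := fun n => Finset.prod_nonneg fun i _ => by positivity
  have hcard : ∀ n, ∑ x ∈ Finset.univ.filter (fun x : Fin r → V n => (fun i => lab n (x i)) = σ),
      (∏ _i : Fin r, (Fintype.card (V n) : ℝ)⁻¹) = c n := by
    intro n
    have : Finset.univ.filter (fun x : Fin r → V n => (fun i => lab n (x i)) = σ)
        = Fintype.piFinset (fun i => Finset.univ.filter (fun v => lab n v = σ i)) := by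
      ext x; simp [funext_iff]
    rw [Finset.sum_const, this, Fintype.card_piFinset, nsmul_eq_mul, hc]
    push_cast
    rw [← Finset.prod_mul_distrib]
    refine Finset.prod_congr rfl fun i _ => ?_
    rw [Nat.card_eq_fintype_card, Fintype.card_subtype, div_eq_mul_inv]
  have hbd : ∀ n (a ε : ℝ), (∀ x : Fin r → V n, (∀ i, lab n (x i) = σ i) → |g n x - a| ≤ ε) →
      |∑ x ∈ Finset.univ.filter (fun x : Fin r → V n => (fun i => lab n (x i)) = σ),
        (∏ _i : Fin r, (Fintype.card (V n) : ℝ)⁻¹) * g n x - c n * a| ≤ c n * ε := by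
    intro n a ε h
    rw [← hcard n, Finset.sum_mul, Finset.sum_mul, ← Finset.sum_sub_distrib]
    refine (Finset.abs_sum_le_sum_abs _ _).trans (Finset.sum_le_sum fun x hx => ?_)
    rw [← mul_sub, abs_mul, abs_of_nonneg (Finset.prod_nonneg fun i _ => by positivity)]
    refine mul_le_mul_of_nonneg_left (h x fun i => ?_) (Finset.prod_nonneg fun i _ => by positivity)
    exact congrFun (Finset.mem_filter.1 hx).2 i
  by_cases hσ : ∀ i, w (σ i) ≠ 0
  · have h2 : Tendsto (fun n => c n * γ σ) atTop (𝓝 ((∏ i, w (σ i)) * γ σ)) := hct.mul_const _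
    refine (tendsto_iff_of_dist ?_).2 h2
    rw [Metric.tendsto_atTop]
    intro ε hε
    set W := ∏ i, w (σ i)
    have hc1 : ∀ᶠ n in atTop, c n < W + 1 := hct.eventually_lt_const (by linarith)
    have hW0 : 0 ≤ W := ge_of_tendsto' hct hc0
    have h3 := hg σ hσ (ε / (2 * (W + 1))) (by positivity)
    obtain ⟨N, hN⟩ := eventually_atTop.1 (hc1.and h3)
    refine ⟨N, fun n hn => ?_⟩
    obtain ⟨h4, h5⟩ := hN n hn
    rw [Real.dist_eq, sub_zero, Real.dist_eq, abs_abs]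
    refine lt_of_le_of_lt (hbd n _ _ h5) ?_
    calc c n * (ε / (2 * (W + 1))) ≤ (W + 1) * (ε / (2 * (W + 1))) := by gcongr
      _ = ε / 2 := by field_simp
      _ < ε := by linarith
  · push Not at hσ
    obtain ⟨i, hi⟩ := hσ
    have hz : ∏ i, w (σ i) = 0 := Finset.prod_eq_zero (Finset.mem_univ i) hi
    rw [hz, zero_mul]
    rw [hz] at hct
    refine squeeze_zero_norm (a := fun n => c n * M) (fun n => ?_) (by simpa using hct.mul_const M)
    have := hbd n 0 M (fun x _ => by simpa using hM n x)
    simpa using this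

theorem aux_sep {T : Type} [MetricSpace T] {p q m : T}
    (h : connectedComponentIn ({m}ᶜ) p ≠ connectedComponentIn ({m}ᶜ) q)
    {C : Set T} (hC : IsPreconnected C) (hp : p ∈ C) (hq : q ∈ C) : m ∈ C := by
  by_contra hm
  have hsub : C ⊆ {m}ᶜ := fun x hx hxm => hm (by rw [← Set.mem_singleton_iff.1 hxm]; exact hx)
  exact h (connectedComponentIn_eq (hC.subset_connectedComponentIn hp hsub hq))

theorem aux_arc_cont {T : Type} [MetricSpace T] {a b : ℝ} {α : ℝ → T}
    (h : ∀ s ∈ Set.Icc a b, ∀ t ∈ Set.Icc a b, dist (α s) (α t) = |s - t|) :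
    ContinuousOn α (Set.Icc a b) := by
  have : LipschitzOnWith 1 α (Set.Icc a b) := by
    refine LipschitzOnWith.of_dist_le_mul fun s hs t ht => ?_
    rw [h s hs t ht, Real.dist_eq]; simp
  exact this.continuousOn

/-- any two points are joined by a compact connected set consisting of between points -/
theorem aux_seg {T : Type} [MetricSpace T] (hT : IsRealTree T) (p q : T) :
    ∃ C : Set T, IsCompact C ∧ IsPreconnected C ∧ p ∈ C ∧ q ∈ C ∧
      ∀ m ∈ C, dist p m + dist m q = dist p q := by
  by_cases hpq : p = q
  · subst hpq
    exact ⟨{p}, isCompact_singleton, isPreconnected_singleton, rfl, rfl, fun m hm => by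
      rw [Set.mem_singleton_iff.1 hm]; simp⟩
  · obtain ⟨a, b, hab, α, hα, rfl, rfl, -⟩ := hT.2.2 p q hpq
    have ha : a ∈ Set.Icc a b := ⟨le_rfl, hab.le⟩
    have hb : b ∈ Set.Icc a b := ⟨hab.le, le_rfl⟩
    refine ⟨α '' Set.Icc a b, isCompact_Icc.image_of_continuousOn (aux_arc_cont hα),
      isPreconnected_Icc.image _ (aux_arc_cont hα), ⟨a, ha, rfl⟩, ⟨b, hb, rfl⟩, ?_⟩
    rintro _ ⟨c, hc, rfl⟩
    rw [hα a ha c hc, hα c hc b hb, hα a ha b hb, abs_of_nonpos, abs_of_nonpos, abs_of_nonpos]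
    · ring
    all_goals linarith [hc.1, hc.2]

theorem aux_median {T : Type} [MetricSpace T] (hT : IsRealTree T) {o y : T} {a b : ℝ} (hab : a < b)
    {α : ℝ → T} (hα : ∀ s ∈ Set.Icc a b, ∀ t ∈ Set.Icc a b, dist (α s) (α t) = |s - t|)
    (ho : α a = o) (hy : α b = y)
    (hsep : ∀ c : ℝ, a < c → c < b →
        connectedComponentIn ({α c}ᶜ) o ≠ connectedComponentIn ({α c}ᶜ) y) (x : T) :
    ∃ c ∈ Set.Icc a b, dist o (α c) + dist (α c) x = dist o x ∧
      dist x (α c) + dist (α c) y = dist x y := by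
  have hcont := aux_arc_cont hα
  let A : Set ℝ := {c | c ∈ Set.Icc a b ∧ dist o (α c) + dist (α c) x = dist o x}
  let B : Set ℝ := {c | c ∈ Set.Icc a b ∧ dist x (α c) + dist (α c) y = dist x y}
  have hA : IsClosed A := by
    have : ContinuousOn (fun c => dist o (α c) + dist (α c) x) (Set.Icc a b) :=
      (continuous_dist.comp_continuousOn (continuousOn_const.prodMk hcont)).add (continuous_dist.comp_continuousOn (hcont.prodMk continuousOn_const))
    exact this.preimage_isClosed_of_isClosed isClosed_Icc (isClosed_singleton (x := dist o x))
  have hB : IsClosed B := by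
    have : ContinuousOn (fun c => dist x (α c) + dist (α c) y) (Set.Icc a b) :=
      (continuous_dist.comp_continuousOn (continuousOn_const.prodMk hcont)).add (continuous_dist.comp_continuousOn (hcont.prodMk continuousOn_const))
    exact this.preimage_isClosed_of_isClosed isClosed_Icc (isClosed_singleton (x := dist x y))
  have ha : a ∈ Set.Icc a b := ⟨le_rfl, hab.le⟩
  have hb : b ∈ Set.Icc a b := ⟨hab.le, le_rfl⟩
  have haA : a ∈ A := ⟨ha, by rw [ho]; simp⟩
  have hbB : b ∈ B := ⟨hb, by rw [hy]; simp⟩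
  have hcov : Set.Icc a b ⊆ A ∪ B := by
    intro c hc
    rcases eq_or_lt_of_le hc.1 with h | h1
    · subst h; exact Or.inl haA
    rcases eq_or_lt_of_le hc.2 with h | h2
    · subst h; exact Or.inr hbB
    obtain ⟨C, -, hC, hoC, hxC, hCb⟩ := aux_seg hT o x
    obtain ⟨D, -, hD, hxD, hyD, hDb⟩ := aux_seg hT x y
    have := aux_sep (hsep c h1 h2) (hC.union x hxC hxD hD) (Or.inl hoC) (Or.inr hyD)
    rcases this with h | h
    · exact Or.inl ⟨hc, hCb _ h⟩
    · exact Or.inr ⟨hc, hDb _ h⟩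
  obtain ⟨c, hc, h1, h2⟩ := isPreconnected_closed_iff.1 (isPreconnected_Icc (a := a) (b := b)) A B hA hB hcov
    ⟨a, ha, haA⟩ ⟨b, hb, hbB⟩
  exact ⟨c, hc, h1.2, h2.2⟩

theorem aux_four {T : Type} [MetricSpace T] (hT : IsRealTree T) (o x y z : T) :
    dist o y + dist x z ≤ max (dist o x + dist y z) (dist o z + dist x y) := by
  by_cases hoy : o = y
  · subst hoy
    rw [dist_self, zero_add, dist_comm o x, dist_comm o z]
    refine le_max_of_le_left ?_
    have := dist_triangle x o z
    rw [dist_comm o z] at this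
    exact this
  obtain ⟨a, b, hab, α, hα, ho, hy, hsep⟩ := hT.2.2 o y hoy
  obtain ⟨s, hs, s1, s2⟩ := aux_median hT hab hα ho hy hsep x
  obtain ⟨t, ht, t1, t2⟩ := aux_median hT hab hα ho hy hsep z
  have ha : a ∈ Set.Icc a b := ⟨le_rfl, hab.le⟩
  have hb : b ∈ Set.Icc a b := ⟨hab.le, le_rfl⟩
  have e1 : dist o y = b - a := by
    rw [← ho, ← hy, hα a ha b hb, abs_of_nonpos (by linarith)]; ring
  have e2 : ∀ c ∈ Set.Icc a b, dist o (α c) = c - a := fun c hc => by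
    rw [← ho, hα a ha c hc, abs_of_nonpos (by linarith [hc.1])]; ring
  have e3 : ∀ c ∈ Set.Icc a b, dist (α c) y = b - c := fun c hc => by
    rw [← hy, hα c hc b hb, abs_of_nonpos (by linarith [hc.2])]; ring
  have e4 := hα s hs t ht
  rw [e2 s hs] at s1
  rw [e2 t ht] at t1
  rw [e3 s hs] at s2
  rw [e3 t ht] at t2
  have tri : dist x z ≤ dist x (α s) + dist (α s) (α t) + dist (α t) z :=
    dist_triangle4 _ _ _ _
  rw [dist_comm (α s) x] at s1
  rw [dist_comm z (α t), dist_comm z y] at t2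
  rcases le_total s t with h | h
  · refine le_max_of_le_right ?_
    rw [abs_of_nonpos (by linarith)] at e4
    linarith
  · refine le_max_of_le_left ?_
    rw [abs_of_nonneg (by linarith)] at e4
    linarith

theorem aux_compact {T : Type} [MetricSpace T] (hT : IsRealTree T)
    (hfin1 : ∃ F : Finset T, ∀ Y : Set T, IsSubtree Y → ↑F ⊆ Y → Y = Set.univ) :
    IsCompact (Set.univ : Set T) := by
  obtain ⟨F, hF⟩ := hfin1
  obtain ⟨o⟩ := hT.1
  choose C h1 h2 h3 h4 _ using aux_seg hT o
  have hc : IsCompact ({o} ∪ ⋃ x ∈ F, C x) :=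
    isCompact_singleton.union (F.isCompact_biUnion fun x _ => h1 x)
  rw [← hF ({o} ∪ ⋃ x ∈ F, C x) ⟨⟨o, Or.inl rfl⟩, hc.isClosed, ?_⟩ ?_]
  · exact hc
  · refine isPreconnected_of_forall o ?_
    rintro y (hy | hy)
    · exact ⟨{o}, subset_union_left, rfl, hy, isPreconnected_singleton⟩
    · obtain ⟨x, hx, hyx⟩ := Set.mem_iUnion₂.1 hy
      exact ⟨C x, fun z hz => Or.inr (Set.mem_iUnion₂.2 ⟨x, hx, hz⟩), h3 x, hyx, h2 x⟩
  · intro x hx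
    exact Or.inr (Set.mem_iUnion₂.2 ⟨x, hx, h4 x⟩)

theorem aux_int_T {T : Type} [MetricSpace T] [MeasurableSpace T] [BorelSpace T]
    [TopologicalSpace.SeparableSpace T] (μ : Measure T) [IsProbabilityMeasure μ]
    (S : Finset T) (hS : μ ↑S = 1) (r : ℕ) (g : BoundedContinuousFunction (Fin r → Fin r → ℝ) ℝ) :
    ∫ x, g x ∂(samplingMeasure (fun x y : T => dist x y) r μ)
      = ∑ σ : Fin r → S, (∏ i, μ.real {(σ i : T)}) * g (rho (fun x y : T => dist x y) r (fun i => (σ i : T))) := by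
  classical
  haveI : SecondCountableTopology T := UniformSpace.secondCountable_of_separable T
  have hcont : Continuous (rho (fun x y : T => dist x y) r) := by
    unfold rho
    refine continuous_pi fun i => continuous_pi fun j => ?_
    by_cases h : i = j
    · simp [h, continuous_const]
    · simp only [h, if_false]; fun_prop
  rw [samplingMeasure, integral_map hcont.measurable.aemeasurable
    g.continuous.aestronglyMeasurable]
  set ν := Measure.pi (fun _ : Fin r => μ) with hν
  have hae : ∀ᵐ x ∂ν, x ∈ ((Fintype.piFinset (fun _ : Fin r => S) : Finset (Fin r → T)) : Set (Fin r → T)) := by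
    have h1 : ∀ i : Fin r, ∀ᵐ x ∂ν, x i ∈ (S : Set T) := by
      intro i
      have h2 : ∀ᵐ y ∂μ, y ∈ (S : Set T) :=
        (mem_ae_iff_prob_eq_one S.measurableSet).2 hS
      exact (Measure.quasiMeasurePreserving_eval (fun _ : Fin r => μ) i).ae h2
    filter_upwards [ae_all_iff.2 h1] with x hx
    simpa using hx
  rw [← Measure.restrict_eq_self_of_ae_mem hae, setIntegral_finset]
  · symm
    refine Finset.sum_bij (fun σ _ => fun i => (σ i : T)) ?_ ?_ ?_ ?_
    · intro σ _; simp
    · intro σ _ σ' _ h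
      funext i
      exact Subtype.ext (congrFun h i)
    · intro x hx
      rw [Fintype.mem_piFinset] at hx
      exact ⟨fun i => ⟨x i, hx i⟩, Finset.mem_univ _, rfl⟩
    · intro σ _
      rw [smul_eq_mul]
      congr 1
      rw [Measure.real, hν, Measure.pi_singleton, ENNReal.toReal_prod]
      rfl
  · exact ((Integrable.of_bound (μ := ν) (g.continuous.comp hcont).aestronglyMeasurable ‖g‖
      (Eventually.of_forall fun x => g.norm_coe_le_norm _)).integrableOn)

theorem aux_int_V {V : Type} [Fintype V] [Nonempty V] (G : SimpleGraph V) (r : ℕ)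
    (g : BoundedContinuousFunction (Fin r → Fin r → ℝ) ℝ) :
    ∫ x, g x ∂(treeSamp G r)
      = ∑ x : Fin r → V, (∏ _i : Fin r, (Fintype.card V : ℝ)⁻¹) * g (rho (treeDist G) r x) := by
  classical
  letI : MeasurableSpace V := ⊤
  set m : Measure V := (Fintype.card V : ℝ≥0∞)⁻¹ • Measure.count with hm
  have hms : ∀ v, m {v} = (Fintype.card V : ℝ≥0∞)⁻¹ := by intro v; simp [hm]
  haveI : IsFiniteMeasure m := by
    constructor
    simp only [hm, Measure.smul_apply, smul_eq_mul]
    rw [Measure.count_apply_finite _ Set.finite_univ]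
    exact ENNReal.mul_lt_top (by simp [Fintype.card_pos]) (by simp)
  have hmeas : Measurable (rho (treeDist G) r) := measurable_of_countable _
  have : treeSamp G r = Measure.map (rho (treeDist G) r) (Measure.pi fun _ => m) := rfl
  rw [this, integral_map hmeas.aemeasurable g.continuous.aestronglyMeasurable, integral_fintype]
  · refine Finset.sum_congr rfl fun x _ => ?_
    rw [smul_eq_mul, Measure.real, Measure.pi_singleton, ENNReal.toReal_prod]
    congr 1
    refine Finset.prod_congr rfl fun i _ => ?_
    rw [hms]; simp
  · exact Integrable.of_bound (measurable_of_countable _).aestronglyMeasurable ‖g‖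
      (Eventually.of_forall fun x => g.norm_coe_le_norm _)

/-- Every finite real tree of diameter at most 1 is the sampling limit of a sequence
of nontrivial finite (graph-theoretic) trees. -/
theorem statement19 {T : Type} [MetricSpace T] [MeasurableSpace T] [BorelSpace T]
    [TopologicalSpace.SeparableSpace T]
    (hT : IsRealTree T) (μ : Measure T) [IsProbabilityMeasure μ]
    (hfin1 : ∃ F : Finset T, ∀ Y : Set T, IsSubtree Y → ↑F ⊆ Y → Y = Set.univ)
    (hfin2 : ∃ S : Finset T, μ ↑S = 1)
    (hdiam : Metric.diam (Set.univ : Set T) ≤ 1) :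
    ∃ (V : ℕ → Type) (instF : ∀ n, Fintype (V n)) (G : ∀ n, SimpleGraph (V n)),
      (∀ n, (G n).IsTree ∧ 1 < @Fintype.card (V n) (instF n)) ∧
      ∀ r : ℕ, 1 ≤ r →
        WeakTendsto (fun n => @treeSamp (V n) (instF n) (G n) r)
          (samplingMeasure (fun x y : T => dist x y) r μ) := by
  classical
  have hd1 : ∀ x y : T, dist x y ≤ 1 := fun x y =>
    (dist_le_diam_of_mem (aux_compact hT hfin1).isBounded (mem_univ x) (mem_univ y)).trans hdiam
  obtain ⟨S, hS⟩ := hfin2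
  obtain ⟨o⟩ := hT.1
  have hne : Nonempty S := by
    rcases S.eq_empty_or_nonempty with h | h
    · subst h; simp at hS
    · exact h.to_subtype
  let w : S → ℝ := fun s => μ.real {(s : T)}
  have hw0 : ∀ s, 0 ≤ w s := fun s => measureReal_nonneg
  have hw1 : ∑ s, w s = 1 := by
    have : ∑ s ∈ S, μ.real {s} = 1 := by
      rw [sum_measureReal_singleton, Measure.real, hS]; rfl
    rw [← this]
    exact Finset.sum_coe_sort S (fun s => μ.real {s})
  let P : S → S → ℝ := fun s t => (dist o s + dist o t - dist (s : T) t) / 2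
  have hPs : ∀ s, P s s = dist o s := fun s => by simp [P]
  have hPd : ∀ s t, P s s + P t t - 2 * P s t = dist (s : T) t := fun s t => by
    rw [hPs, hPs]; simp only [P]; ring
  let k : ℕ → S → ℕ := fun n s => ⌊w s * ((n + 1 : ℕ) : ℝ) ^ 2⌋₊ + 1
  have key := fun n : ℕ => aux_tree4 (n + 1) (by omega) (k n) (fun s => Nat.succ_pos _) P
    (fun s t => by simp only [P]; rw [dist_comm (s : T) t]; ring)
    (fun s t => by
      have := dist_triangle_left (s : T) t o
      simp only [P]; linarith)
    (fun s t => by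
      rw [hPs]
      have := dist_triangle o (s : T) t
      simp only [P]; linarith)
    (fun s t u => by
      have := aux_four hT o s t u
      simp only [P]
      rcases le_max_iff.1 this with h | h
      · exact min_le_of_right_le (by linarith)
      · exact min_le_of_left_le (by linarith))
    (fun s => by rw [hPs]; exact hd1 _ _)
    (fun s t => by rw [hPd]; exact hd1 _ _)
  choose V instF G lab hG hl1 hl2 hc hdist using key
  refine ⟨V, instF, G, fun n => ⟨hG n, hc n⟩, fun r _ g => ?_⟩
  have hneV : ∀ n, Nonempty (V n) := fun n => Fintype.card_pos_iff.1 (by have := hc n; omega)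
  simp_rw [aux_int_V]
  rw [aux_int_T μ S hS]
  let w' : Option S → ℝ := fun k => k.elim 0 w
  let γ : (Fin r → Option S) → ℝ := fun σ =>
    g (rho (fun x y : T => dist x y) r (fun i => (σ i).elim o (fun s => (s : T))))
  have hlim : ∑ σ : Fin r → S, (∏ i, μ.real {(σ i : T)}) *
      g (rho (fun x y : T => dist x y) r (fun i => (σ i : T)))
      = ∑ σ : Fin r → Option S, (∏ i, w' (σ i)) * γ σ := by
    refine Fintype.sum_of_injective (fun σ i => some (σ i)) ?_ _ _ ?_ ?_
    · intro σ σ' h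
      funext i
      exact Option.some.inj (congrFun h i)
    · intro σ hσ
      have : ∃ i, σ i = none := by
        by_contra hcon
        push Not at hcon
        choose τ hτ using fun i => Option.ne_none_iff_exists'.1 (hcon i)
        exact hσ ⟨τ, funext fun i => (hτ i).symm⟩
      obtain ⟨i, hi⟩ := this
      rw [Finset.prod_eq_zero (Finset.mem_univ i) (by simp [w', hi]), zero_mul]
    · intro σ; rfl
  rw [hlim]
  have hN : Tendsto (fun n : ℕ => ((n + 1 : ℕ) : ℝ)) atTop atTop :=
    tendsto_natCast_atTop_atTop.comp (tendsto_add_atTop_nat 1)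
  have hN2 : Tendsto (fun n : ℕ => ((n + 1 : ℕ) : ℝ) ^ 2) atTop atTop :=
    (tendsto_pow_atTop (by norm_num)).comp hN
  have ha : ∀ κ, Tendsto (fun n => (Nat.card {v // lab n v = κ} : ℝ) / ((n + 1 : ℕ) : ℝ) ^ 2) atTop
      (𝓝 (w' κ)) := by
    rintro (_ | s)
    · refine squeeze_zero (g := fun n : ℕ => (Fintype.card S + 1 : ℝ) * 3 * (((n + 1 : ℕ) : ℝ))⁻¹)
        (fun n => by positivity) (fun n => ?_) ?_
      · have h1 : (Nat.card {v // lab n v = none} : ℝ) ≤ (Fintype.card S + 1) * ((n + 1 : ℕ) + 2) := by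
          exact_mod_cast hl2 n
        have h2 : (1 : ℝ) ≤ ((n + 1 : ℕ) : ℝ) := by exact_mod_cast Nat.succ_pos n
        set N : ℝ := ((n + 1 : ℕ) : ℝ)
        rw [div_le_iff₀ (by positivity)]
        refine h1.trans ?_
        rw [show (Fintype.card S + 1 : ℝ) * 3 * N⁻¹ * N ^ 2 = (Fintype.card S + 1 : ℝ) * (3 * N) by
          field_simp]
        gcongr
        linarith
      · have := (tendsto_inv_atTop_zero.comp hN).const_mul ((Fintype.card S + 1 : ℝ) * 3)
        simpa using this
    · have h1 := (tendsto_nat_floor_mul_div_atTop (R := ℝ) (hw0 s)).comp hN2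
      have h2 := h1.add (tendsto_inv_atTop_zero.comp hN2)
      rw [add_zero] at h2
      refine h2.congr fun n => ?_
      rw [hl1 n s]
      simp only [Function.comp, k]
      push_cast
      rw [add_div, one_div]
  have hV : Tendsto (fun n => (Fintype.card (V n) : ℝ) / ((n + 1 : ℕ) : ℝ) ^ 2) atTop (𝓝 1) := by
    have h1 := tendsto_finsetSum Finset.univ (fun κ (_ : κ ∈ Finset.univ) => ha κ)
    have h2 : ∑ κ, w' κ = 1 := by
      rw [Fintype.sum_option]; simpa [w'] using hw1
    rw [h2] at h1
    refine h1.congr fun n => ?_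
    rw [← Finset.sum_div, ← Nat.cast_sum]
    congr 2
    rw [← Nat.card_eq_fintype_card, ← Nat.card_sigma]
    exact Nat.card_congr (Equiv.sigmaFiberEquiv (lab n))
  refine aux_conv r w' V lab ?_ (fun n x => g (rho (treeDist (G n)) r x)) ‖g‖
    (fun n x => g.norm_coe_le_norm _) γ ?_
  · intro κ
    have := (ha κ).div hV one_ne_zero
    rw [div_one] at this
    refine this.congr fun n => ?_
    have h2 : (((n + 1 : ℕ) : ℝ) ^ 2) ≠ 0 := by positivity
    simp only [Pi.div_apply]
    rw [div_div_div_cancel_right₀ h2]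
  · intro σ hσ ε hε
    have hsome : ∀ i, ∃ s, σ i = some s := by
      intro i
      rcases h : σ i with _ | s
      · exact absurd (by simp [w', h]) (hσ i)
      · exact ⟨s, rfl⟩
    choose τ hτ using hsome
    obtain ⟨δ, hδ, hgδ⟩ := Metric.continuousAt_iff.1 (g.continuous.continuousAt
      (x := rho (fun x y : T => dist x y) r (fun i => (τ i : T)))) ε hε
    have h8 : Tendsto (fun n : ℕ => 8 / ((n + 1 : ℕ) : ℝ)) atTop (𝓝 0) := hN.const_div_atTop 8
    filter_upwards [h8.eventually_lt_const hδ] with n hn x hx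
    have hγ : γ σ = g (rho (fun x y : T => dist x y) r (fun i => (τ i : T))) := by
      simp only [γ, hτ, Option.elim]
    rw [hγ, ← Real.dist_eq]
    refine (hgδ (lt_of_le_of_lt ?_ hn)).le
    refine (dist_pi_le_iff (by positivity)).2 fun i => (dist_pi_le_iff (by positivity)).2 fun j => ?_
    simp only [rho]
    split_ifs with hij
    · rw [dist_self]; positivity
    · rw [Real.dist_eq, ← hPd]
      exact hdist n _ _ _ _ ((hx i).trans (hτ i)) ((hx j).trans (hτ j))

end
end
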